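/- arXiv:1111.6316 — 4 statements merged into one kernel-verified Lean document; each statement's English description precedes it below -/
import Mathlib

section
/- Suppose G is 2-torsion free and the following three conditions hold: (1) Z(A)_k = π_A(Z(G)); (2) Z(B)_k = π_B(Z(G)); (3) there exist m0 ∈ M and n0 ∈ N such that Z(G) = {a + b : a ∈ Z(A), b ∈ Z(B), am0 = m0b, n0a = bn0}. Then every k-commuting R-linear map Θ: G → G is proper, i.e., there exist λ ∈ Z(G) and an R-linear map ζ: G → Z(G) such that Θ(g) = λg + ζ(g) for all g ∈ G. -/
/-- The iterated commutator: `iterComm 0 x y = x`, `iterComm (i+1) x y = [iterComm i x y, y]`. -/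
def iterComm {G : Type*} [Ring G] : ℕ → G → G → G
  | 0, x, _ => x
  | i + 1, x, y => iterComm i x y * y - y * iterComm i x y

section IterComm

variable {G : Type*} [Ring G]

theorem iterComm_add (k : ℕ) (x y g : G) :
    iterComm k (x + y) g = iterComm k x g + iterComm k y g := by
  induction k with
  | zero => rfl
  | succ k ih => simp only [iterComm, ih]; noncomm_ring

theorem iterComm_sub (k : ℕ) (x y g : G) :
    iterComm k (x - y) g = iterComm k x g - iterComm k y g := by
  induction k with
  | zero => rfl
  | succ k ih => simp only [iterComm, ih]; noncomm_ring

theorem iterComm_add_one_right (k : ℕ) (x g : G) : iterComm k x (g + 1) = iterComm k x g := by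
  induction k with
  | zero => rfl
  | succ k ih => simp only [iterComm, ih]; noncomm_ring

theorem iterComm_eq_zero_of_commute {k : ℕ} (hk : k ≠ 0) {x g : G} (h : x * g = g * x) :
    iterComm k x g = 0 := by
  obtain ⟨k, rfl⟩ := Nat.exists_eq_succ_of_ne_zero hk
  induction k with
  | zero => simp [iterComm, h]
  | succ k ih =>
    have := ih (Nat.succ_ne_zero k)
    simp only [Nat.succ_eq_add_one] at this ⊢
    rw [iterComm, this]; simp

theorem iterComm_conj (k : ℕ) {u v : G} (huv : u * v = 1) (x y : G) :
    iterComm k (u * x * v) y = u * iterComm k x (v * y * u) * v := by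
  induction k with
  | zero => rfl
  | succ k ih =>
    rw [iterComm, iterComm, ih]
    generalize iterComm k x (v * y * u) = c
    calc u * c * v * y - y * (u * c * v)
        = u * c * v * y * 1 - 1 * y * u * c * v := by noncomm_ring
      _ = u * c * v * y * (u * v) - (u * v) * y * u * c * v := by rw [huv]
      _ = _ := by noncomm_ring

/-- For an idempotent `p`, the operator `x ↦ [x, p]` satisfies `T ^ 3 = T`, so a vanishing iterated
commutator forces commutation. -/
theorem commute_of_iterComm_idempotent {p : G} (hp : p * p = p) {x : G} (k : ℕ)
    (h : iterComm k x p = 0) : x * p = p * x := by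
  have hp' : ∀ y, p * (p * y) = p * y := fun y => by rw [← mul_assoc, hp]
  have cube : ∀ i, iterComm (i + 3) x p = iterComm (i + 1) x p := fun i => by
    simp only [iterComm]
    simp only [mul_sub, sub_mul, mul_assoc, hp, hp']
    noncomm_ring
  have key : ∀ i, iterComm (i + 1) x p = 0 → x * p = p * x := by
    intro i
    induction i with
    | zero => intro h; exact sub_eq_zero.mp h
    | succ i ih =>
      intro h
      apply ih
      rw [← cube, iterComm, h]; simp
  exact key k (by rw [iterComm, h]; simp)

theorem corner_iterComm_left (k : ℕ) {u v g c : G} (t : ℤ) (hu : u * g = c * u)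
    (hv : g * v = t * v) (x : G) :
    u * iterComm k x g * v = ((t : G) - c) ^ k * (u * x * v) := by
  induction k with
  | zero => simp [iterComm]
  | succ k ih =>
    rw [iterComm, pow_succ', mul_assoc _ _ (u * x * v), ← ih]
    generalize iterComm k x g = y
    calc u * (y * g - g * y) * v = u * y * (g * v) - (u * g) * y * v := by noncomm_ring
      _ = u * (y * t) * v - c * u * y * v := by rw [hu, hv]; noncomm_ring
      _ = u * (t * y) * v - c * u * y * v := by rw [(Int.cast_commute t y).eq]
      _ = (u * t) * y * v - c * u * y * v := by noncomm_ring
      _ = _ := by rw [← (Int.cast_commute t u).eq]; noncomm_ring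

theorem corner_iterComm_right (k : ℕ) {u v g d : G} (t : ℤ) (hu : u * g = t * u)
    (hv : g * v = v * d) (x : G) :
    u * iterComm k x g * v = u * x * v * (d - t) ^ k := by
  induction k with
  | zero => simp [iterComm]
  | succ k ih =>
    rw [iterComm, pow_succ, ← mul_assoc, ← ih]
    generalize iterComm k x g = y
    calc u * (y * g - g * y) * v = u * y * (g * v) - (u * g) * y * v := by noncomm_ring
      _ = u * y * v * d - t * (u * y * v) := by rw [hu, hv]; noncomm_ring
      _ = _ := by rw [(Int.cast_commute t (u * y * v)).eq]; noncomm_ring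

theorem exists_pow_comb_eq_one (k : ℕ) (c : G) :
    ∃ p q : G, p * (0 - c) ^ k + q * (1 - c) ^ k = 1 ∧
      (0 - c) ^ k * p + (1 - c) ^ k * q = 1 := by
  have h : IsCoprime ((0 - Polynomial.X : Polynomial ℤ) ^ k) ((1 - Polynomial.X) ^ k) :=
    IsCoprime.pow ⟨-1, 1, by ring⟩
  obtain ⟨p, q, hpq⟩ := h
  refine ⟨Polynomial.aeval c p, Polynomial.aeval c q, ?_, ?_⟩
  · simpa using congrArg (Polynomial.aeval c) hpq
  · rw [mul_comm p, mul_comm q] at hpq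
    simpa using congrArg (Polynomial.aeval c) hpq

theorem eq_zero_of_pow_mul_eq_zero {k : ℕ} {c y : G} (h0 : (0 - c) ^ k * y = 0)
    (h1 : (1 - c) ^ k * y = 0) : y = 0 := by
  obtain ⟨p, q, h, -⟩ := exists_pow_comb_eq_one k c
  rw [← one_mul y, ← h, add_mul, mul_assoc, mul_assoc, h0, h1]; simp

theorem eq_zero_of_mul_pow_eq_zero {k : ℕ} {d y : G} (h0 : y * (d - 0) ^ k = 0)
    (h1 : y * (d - 1) ^ k = 0) : y = 0 := by
  obtain ⟨p, q, -, h⟩ := exists_pow_comb_eq_one k d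
  have h0' : y * (0 - d) ^ k = 0 := by
    rw [← neg_sub, neg_pow', ← mul_assoc, h0, zero_mul]
  have h1' : y * (1 - d) ^ k = 0 := by
    rw [← neg_sub, neg_pow', ← mul_assoc, h1, zero_mul]
  rw [← mul_one y, ← h, mul_add, ← mul_assoc, ← mul_assoc, h0', h1']; simp

/-- Compression by `p` is multiplicative on block lower triangular elements. -/
theorem compress_iterComm_of_lower (k : ℕ) {p q g x : G} (hp : p * p = p) (hpq : p + q = 1)
    (hg : p * g * q = 0) (hx : p * x * q = 0) :
    p * iterComm k x g * p = iterComm k (p * x * p) (p * g * p) := by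
  obtain rfl : q = 1 - p := eq_sub_of_add_eq' hpq
  have hg' : p * g = p * g * p := by simpa [mul_sub, sub_eq_zero] using hg
  have hx' : p * x = p * x * p := by simpa [mul_sub, sub_eq_zero] using hx
  have key : p * iterComm k x g = p * iterComm k x g * p ∧
      p * iterComm k x g * p = iterComm k (p * x * p) (p * g * p) := by
    induction k with
    | zero => exact ⟨hx', rfl⟩
    | succ k ih =>
      obtain ⟨h1, h2⟩ := ih
      rw [iterComm, iterComm, ← h2]
      generalize iterComm k x g = y at h1 h2
      have mul_eq : ∀ s t, p * s = p * s * p → p * t = p * t * p →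
          p * (s * t) = p * s * p * (p * t * p) := fun s t hs ht => by
        calc p * (s * t) = p * s * p * t := by rw [← hs, mul_assoc]
          _ = p * s * p * (p * t) := by rw [mul_assoc (p * s) p (p * t), ← mul_assoc p p t, hp,
            mul_assoc (p * s) p t]
          _ = _ := by rw [← ht]
      have e1 : p * (y * g - g * y) = p * y * p * (p * g * p) - p * g * p * (p * y * p) := by
        rw [mul_sub, mul_eq y g h1 hg', mul_eq g y hg' h1]
      rw [e1]
      refine ⟨?_, ?_⟩ <;> simp only [sub_mul, mul_assoc, hp]
  exact key.2

/-- Compression by `p` is multiplicative on block upper triangular elements. -/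
theorem compress_iterComm_of_upper (k : ℕ) {p q g x : G} (hp : p * p = p) (hpq : p + q = 1)
    (hg : q * g * p = 0) (hx : q * x * p = 0) :
    p * iterComm k x g * p = iterComm k (p * x * p) (p * g * p) := by
  obtain rfl : q = 1 - p := eq_sub_of_add_eq' hpq
  have hg' : g * p = p * g * p := by simpa [sub_mul, sub_eq_zero] using hg
  have hx' : x * p = p * x * p := by simpa [sub_mul, sub_eq_zero] using hx
  have key : iterComm k x g * p = p * iterComm k x g * p ∧
      p * iterComm k x g * p = iterComm k (p * x * p) (p * g * p) := by
    induction k with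
    | zero => exact ⟨hx', rfl⟩
    | succ k ih =>
      obtain ⟨h1, h2⟩ := ih
      rw [iterComm, iterComm, ← h2]
      generalize iterComm k x g = y at h1 h2
      have hpp : ∀ w, p * (p * w) = p * w := fun w => by rw [← mul_assoc, hp]
      have mul_eq : ∀ s t, s * p = p * s * p → t * p = p * t * p →
          s * t * p = p * s * p * (p * t * p) := fun s t hs ht => by
        calc s * t * p = s * (p * t * p) := by rw [← ht, mul_assoc]
          _ = s * p * (p * t * p) := by simp only [mul_assoc, hpp]
          _ = _ := by rw [← hs]
      have e1 : (y * g - g * y) * p = p * y * p * (p * g * p) - p * g * p * (p * y * p) := by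
        rw [sub_mul, mul_eq y g h1 hg', mul_eq g y hg' h1]
      rw [mul_assoc, e1]
      refine ⟨?_, ?_⟩ <;> simp only [mul_sub, mul_assoc, hpp]
  exact key.2

end IterComm

/-- `x` lies in the Peirce corner `pGq`, for idempotents `p` and `q`. -/
def IsPeirce {G : Type*} [Ring G] (p q x : G) : Prop := p * x = x ∧ x * q = x

section Peirce

variable {G : Type*} [Ring G] {e f : G}

theorem isPeirce_iff {p q : G} (hp : p * p = p) (hq : q * q = q) {x : G} :
    IsPeirce p q x ↔ x = p * x * q := by
  constructor
  · rintro ⟨h1, h2⟩; rw [h1, h2]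
  · intro h
    constructor
    · rw [h, ← mul_assoc, ← mul_assoc, hp]
    · rw [h, mul_assoc _ q q, hq]

theorem isPeirce_mul_mul {p q : G} (hp : p * p = p) (hq : q * q = q) (x : G) :
    IsPeirce p q (p * x * q) :=
  ⟨by rw [← mul_assoc, ← mul_assoc, hp], by rw [mul_assoc _ q q, hq]⟩

theorem IsPeirce.mul {p q r x y : G} (hx : IsPeirce p q x) (hy : IsPeirce q r y) :
    IsPeirce p r (x * y) :=
  ⟨by rw [← mul_assoc, hx.1], by rw [mul_assoc, hy.2]⟩

theorem IsPeirce.add {p q x y : G} (hx : IsPeirce p q x) (hy : IsPeirce p q y) :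
    IsPeirce p q (x + y) :=
  ⟨by rw [mul_add, hx.1, hy.1], by rw [add_mul, hx.2, hy.2]⟩

theorem IsPeirce.neg {p q x : G} (hx : IsPeirce p q x) : IsPeirce p q (-x) :=
  ⟨by rw [mul_neg, hx.1], by rw [neg_mul, hx.2]⟩

theorem IsPeirce.mul_eq_zero {p q r s x y : G} (hx : IsPeirce p q x) (hy : IsPeirce r s y)
    (h : q * r = 0) : x * y = 0 := by
  rw [← hx.2, ← hy.1, mul_assoc, ← mul_assoc q, h, zero_mul, mul_zero]

theorem IsPeirce.left_eq_zero {p q r x : G} (hx : IsPeirce p q x) (h : r * p = 0) :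
    r * x = 0 := by
  rw [← hx.1, ← mul_assoc, h, zero_mul]

theorem IsPeirce.right_eq_zero {p q r x : G} (hx : IsPeirce p q x) (h : q * r = 0) :
    x * r = 0 := by
  rw [← hx.2, mul_assoc, h, mul_zero]

theorem compl_relations (he : e * e = e) (hef : e + f = 1) :
    f * f = f ∧ e * f = 0 ∧ f * e = 0 := by
  obtain rfl : f = 1 - e := eq_sub_of_add_eq' hef
  simp [mul_sub, sub_mul, he]

theorem commute_of_compl {x : G} (hef : e + f = 1) (h : x * e = e * x) : x * f = f * x := by
  obtain rfl : f = 1 - e := eq_sub_of_add_eq' hef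
  simp [mul_sub, sub_mul, h]

theorem commute_of_offdiag_eq_zero {x : G} (hef : e + f = 1) (h1 : e * x * f = 0)
    (h2 : f * x * e = 0) : x * e = e * x := by
  obtain rfl : f = 1 - e := eq_sub_of_add_eq' hef
  simp only [mul_sub, mul_one, sub_mul, one_mul, sub_eq_zero] at h1 h2
  rw [h1, h2]

variable {k : ℕ} {T : G →+ G}

/-- A `k`-commuting map sends the corner `eGe` to elements commuting with `e`. -/
theorem commute_map_of_isPeirce (he : e * e = e) (hef : e + f = 1)
    (hT : ∀ g, iterComm k (T g) g = 0) {a : G} (ha : IsPeirce e e a) :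
    T a * e = e * T a := by
  obtain ⟨hf, hef0, hfe0⟩ := compl_relations he hef
  have hTf : T f * e = e * T f := by
    have := commute_of_iterComm_idempotent hf k (hT f)
    exact commute_of_compl (by rwa [add_comm]) this
  have hTf1 : e * T f * f = 0 := by rw [← hTf, mul_assoc, hef0, mul_zero]
  have hTf2 : f * T f * e = 0 := by rw [mul_assoc, hTf, ← mul_assoc, hfe0, zero_mul]
  have haf : a * f = 0 := ha.right_eq_zero hef0
  have hfa : f * a = 0 := ha.left_eq_zero hfe0
  apply commute_of_offdiag_eq_zero hef
  · have h0 := corner_iterComm_left k (u := e) (v := f) (g := a) (c := a) 0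
      (by rw [ha.1, ha.2]) (by simp [haf]) (T a)
    have h1 := corner_iterComm_left k (u := e) (v := f) (g := a + f) (c := a) 1
      (by rw [mul_add, ha.1, ha.2, hef0, add_zero]) (by simp [add_mul, haf, hf]) (T (a + f))
    rw [hT, map_add, mul_add, add_mul, hTf1, add_zero] at h1
    rw [hT] at h0
    exact eq_zero_of_pow_mul_eq_zero (by simpa using h0.symm) (by simpa using h1.symm)
  · have h0 := corner_iterComm_right k (u := f) (v := e) (g := a) (d := a) 0
      (by simp [hfa]) (by rw [ha.1, ha.2]) (T a)
    have h1 := corner_iterComm_right k (u := f) (v := e) (g := a + f) (d := a) 1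
      (by simp [mul_add, hfa, hf]) (by rw [add_mul, ha.1, ha.2, hfe0, add_zero]) (T (a + f))
    rw [hT, map_add, mul_add, add_mul, hTf2, add_zero] at h1
    rw [hT] at h0
    exact eq_zero_of_mul_pow_eq_zero (by simpa using h0.symm) (by simpa using h1.symm)

theorem commute_map_of_isPeirce_diag (he : e * e = e) (hef : e + f = 1)
    (hT : ∀ g, iterComm k (T g) g = 0) {c : G} (hc : IsPeirce e e c ∨ IsPeirce f f c) :
    T c * e = e * T c := by
  rcases hc with hc | hc
  · exact commute_map_of_isPeirce he hef hT hc
  · have hfe : f + e = 1 := by rwa [add_comm]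
    exact commute_of_compl hfe
      (commute_map_of_isPeirce (compl_relations he hef).1 hfe hT hc)

/-- If `e ± u` and `e` are idempotent, then a `k`-commuting map commutes on `u` and the polarized
identity at `(e, u)` holds. -/
theorem commute_map_of_offdiag (htf : ∀ g : G, g + g = 0 → g = 0) (he : e * e = e)
    (hT : ∀ g, iterComm k (T g) g = 0) {u : G} (hu : e * u + u * e = u) (huu : u * u = 0) :
    T u * u = u * T u ∧ (T e * u - u * T e) + (T u * e - e * T u) = 0 := by
  have h0 := commute_of_iterComm_idempotent he k (hT e)
  have h1 := commute_of_iterComm_idempotent (p := e + u)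
    (by
      calc (e + u) * (e + u) = e * e + (e * u + u * e) + u * u := by noncomm_ring
        _ = e + u := by rw [he, hu, huu, add_zero]) k (hT _)
  have h2 := commute_of_iterComm_idempotent (p := e - u)
    (by
      calc (e - u) * (e - u) = e * e - (e * u + u * e) + u * u := by noncomm_ring
        _ = e - u := by rw [he, hu, huu, add_zero]) k (hT _)
  rw [map_add] at h1
  rw [map_sub] at h2
  have h3 : T u * u = u * T u := by
    rw [← sub_eq_zero]
    apply htf
    calc T u * u - u * T u + (T u * u - u * T u)
        = ((T e + T u) * (e + u) - (e + u) * (T e + T u))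
          + ((T e - T u) * (e - u) - (e - u) * (T e - T u))
          - (T e * e - e * T e) - (T e * e - e * T e) := by noncomm_ring
      _ = 0 := by rw [h1, h2, h0]; simp
  refine ⟨h3, ?_⟩
  calc (T e * u - u * T e) + (T u * e - e * T u)
      = ((T e + T u) * (e + u) - (e + u) * (T e + T u)) - (T e * e - e * T e)
        - (T u * u - u * T u) := by noncomm_ring
    _ = 0 := by rw [h1, h0, h3]; simp

theorem commute_add_map_of_conj (he : e * e = e) (hef : e + f = 1)
    (hT : ∀ g, iterComm k (T g) g = 0) (hdiag : ∀ g, T g * e = e * T g) {c m : G}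
    (hc : IsPeirce e e c ∨ IsPeirce f f c) (hm : IsPeirce e f m) :
    T (c + (c * m - m * c)) * m = m * T (c + (c * m - m * c)) := by
  obtain ⟨hf, hef0, hfe0⟩ := compl_relations he hef
  have hme : m * e = 0 := hm.right_eq_zero hfe0
  have hmm : m * m = 0 := hm.mul_eq_zero hm hfe0
  have huv : (1 + m) * (1 - m) = 1 := by
    calc (1 + m) * (1 - m) = 1 - m * m := by noncomm_ring
      _ = 1 := by rw [hmm, sub_zero]
  let S : G →+ G := (AddMonoidHom.mulLeft (1 + m)).comp ((AddMonoidHom.mulRight (1 - m)).comp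
    (T.comp ((AddMonoidHom.mulLeft (1 - m)).comp (AddMonoidHom.mulRight (1 + m)))))
  have hS : ∀ g, S g = (1 + m) * T ((1 - m) * g * (1 + m)) * (1 - m) := fun g => by
    simp [S, mul_assoc]
  have hSk : ∀ g, iterComm k (S g) g = 0 := fun g => by
    rw [hS, iterComm_conj k huv, hT]; simp
  have hcomm := commute_map_of_isPeirce_diag he hef hSk hc
  have hmcm : m * c * m = 0 := by
    rcases hc with hc | hc
    · rw [hm.mul_eq_zero hc hfe0, zero_mul]
    · rw [mul_assoc, hc.mul_eq_zero hm hfe0, mul_zero]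
  have hconj : (1 - m) * c * (1 + m) = c + (c * m - m * c) := by
    calc (1 - m) * c * (1 + m) = c + (c * m - m * c) - m * c * m := by noncomm_ring
      _ = _ := by rw [hmcm, sub_zero]
  rw [hS, hconj] at hcomm
  have hD := hdiag (c + (c * m - m * c))
  generalize T (c + (c * m - m * c)) = D at hcomm hD
  have hmDe : m * D * e = 0 := by rw [mul_assoc, hD, ← mul_assoc, hme, zero_mul]
  have hmDm : m * D * m = 0 := by rw [← hm.1, ← mul_assoc, hm.1, hmDe, zero_mul]
  have heDm : e * D * m = D * m := by rw [← hD, mul_assoc, hm.1]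
  have h1 : (1 + m) * D * (1 - m) * e = D * e := by
    calc (1 + m) * D * (1 - m) * e
        = D * e + m * D * e - D * (m * e) - m * D * (m * e) := by noncomm_ring
      _ = D * e := by rw [hmDe, hme]; simp
  have h2 : e * ((1 + m) * D * (1 - m)) = e * D + m * D - D * m := by
    calc e * ((1 + m) * D * (1 - m))
        = e * D + e * m * D - e * D * m - e * (m * D * m) := by noncomm_ring
      _ = _ := by rw [hmDm, hm.1, heDm]; simp
  rw [h1, h2, hD, add_sub_assoc, left_eq_add, sub_eq_zero] at hcomm
  exact hcomm.symm

theorem commute_map_diag_of_isPeirce (htf : ∀ g : G, g + g = 0 → g = 0) (he : e * e = e)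
    (hef : e + f = 1) (hT : ∀ g, iterComm k (T g) g = 0) (hdiag : ∀ g, T g * e = e * T g)
    {c m : G} (hc : IsPeirce e e c ∨ IsPeirce f f c) (hm : IsPeirce e f m) :
    T c * m = m * T c := by
  have h1 := commute_add_map_of_conj he hef hT hdiag hc hm
  have h2 := commute_add_map_of_conj he hef hT hdiag hc hm.neg
  have h3 : c * -m - -m * c = -(c * m - m * c) := by noncomm_ring
  rw [h3] at h2
  generalize c * m - m * c = w at h1 h2
  rw [map_add] at h1 h2
  rw [map_neg] at h2
  rw [← sub_eq_zero]
  apply htf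
  calc T c * m - m * T c + (T c * m - m * T c)
      = ((T c + T w) * m - m * (T c + T w))
        - ((T c + -T w) * -m - -m * (T c + -T w)) := by noncomm_ring
    _ = 0 := by rw [h1, h2]; simp

theorem iterComm_compress_map {p q : G} (hp : p * p = p) (hpq : p + q = 1)
    (hT : ∀ g, iterComm k (T g) g = 0) {x y : G} (hx : IsPeirce p p x)
    (hTx : T x * p = p * T x) (hTy : T y * p = p * T y) (hy : p * y * p = 0)
    (hy' : p * y * q = 0 ∨ q * y * p = 0) :
    iterComm k (p * T y * p) x = 0 := by
  obtain ⟨hq, hpq0, hqp0⟩ := compl_relations hp hpq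
  have hlow : ∀ z, z * p = p * z → p * z * q = 0 := fun z hz => by
    rw [← hz, mul_assoc, hpq0, mul_zero]
  have hupp : ∀ z, z * p = p * z → q * z * p = 0 := fun z hz => by
    rw [mul_assoc, hz, ← mul_assoc, hqp0, zero_mul]
  have hTxy : T (x + y) * p = p * T (x + y) := by rw [map_add, add_mul, mul_add, hTx, hTy]
  have hxp : p * x * p = x := by rw [hx.1, hx.2]
  have hpxq : p * x * q = 0 := by rw [hx.1, hx.right_eq_zero hpq0]
  have hqxp : q * x * p = 0 := by rw [hx.left_eq_zero hqp0, zero_mul]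
  have h1 := compress_iterComm_of_lower k hp hpq hpxq (hlow _ hTx)
  rw [hT, hxp] at h1
  have h2 : p * iterComm k (T (x + y)) (x + y) * p = iterComm k (p * T (x + y) * p) x := by
    have h3 : p * (x + y) * p = x := by rw [mul_add, add_mul, hy, add_zero, hxp]
    rcases hy' with hy' | hy'
    · rw [compress_iterComm_of_lower k hp hpq (by rw [mul_add, add_mul, hpxq, hy', add_zero])
        (hlow _ hTxy), h3]
    · rw [compress_iterComm_of_upper k hp hpq (by rw [mul_add, add_mul, hqxp, hy', add_zero])
        (hupp _ hTxy), h3]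
  rw [hT, map_add, mul_add, add_mul, iterComm_add, ← h1] at h2
  simpa using h2.symm

theorem mem_center_of_left (hef : e + f = 1)
    (hR : ∀ b : G, IsPeirce f f b → (∀ m, IsPeirce e f m → m * b = 0) → b = 0) (he : e * e = e)
    {D z : G} (hD : D * e = e * D) (hDm : ∀ m, IsPeirce e f m → D * m = m * D)
    (hz : z ∈ Subring.center G) (hDz : e * D = e * z) : D ∈ Subring.center G := by
  obtain ⟨hf, hef0, hfe0⟩ := compl_relations he hef
  rw [Subring.mem_center_iff] at hz
  have h1 : e * (D - z) = 0 := by rw [mul_sub, hDz, sub_self]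
  have h1' : (D - z) * e = 0 := by rw [sub_mul, hD, hDz, hz, sub_self]
  have : D - z = 0 := by
    apply hR
    · obtain rfl : f = 1 - e := eq_sub_of_add_eq' hef
      exact ⟨by rw [sub_mul, h1]; simp, by rw [mul_sub, h1']; simp⟩
    · intro m hm
      rw [mul_sub, ← hDm m hm, hz, ← sub_mul, ← hm.1, ← mul_assoc, h1', zero_mul]
  rw [sub_eq_zero.mp this]
  exact Subring.mem_center_iff.mpr hz

theorem mem_center_of_right (hef : e + f = 1)
    (hL : ∀ a : G, IsPeirce e e a → (∀ m, IsPeirce e f m → a * m = 0) → a = 0) (he : e * e = e)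
    {D z : G} (hD : D * e = e * D) (hDm : ∀ m, IsPeirce e f m → D * m = m * D)
    (hz : z ∈ Subring.center G) (hDz : f * D = f * z) : D ∈ Subring.center G := by
  obtain ⟨hf, hef0, hfe0⟩ := compl_relations he hef
  rw [Subring.mem_center_iff] at hz
  have h1 : f * (D - z) = 0 := by rw [mul_sub, hDz, sub_self]
  have h1' : (D - z) * f = 0 := by
    rw [sub_mul, commute_of_compl hef hD, hDz, hz, sub_self]
  have : D - z = 0 := by
    apply hL
    · obtain rfl : e = 1 - f := eq_sub_of_add_eq hef
      exact ⟨by rw [sub_mul, h1]; simp, by rw [mul_sub, h1']; simp⟩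
    · intro m hm
      rw [sub_mul, hDm m hm, ← hz, ← mul_sub, ← hm.2, mul_assoc, h1, mul_zero]
  rw [sub_eq_zero.mp this]
  exact Subring.mem_center_iff.mpr hz

theorem commute_map_of_conj_idempotent (he : e * e = e) (hef : e + f = 1)
    (hT : ∀ g, iterComm k (T g) g = 0) (hdiag : ∀ g, T g * e = e * T g)
    (hcent : ∀ c, IsPeirce e e c ∨ IsPeirce f f c → T c ∈ Subring.center G) {m n : G}
    (hm : IsPeirce e f m) (hn : IsPeirce f e n) (hTm : T m * m = m * T m) :
    T (n + n * m * n) * m = m * T (n + n * m * n) := by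
  obtain ⟨hf, hef0, hfe0⟩ := compl_relations he hef
  have hme : m * e = 0 := hm.right_eq_zero hfe0
  have hen : e * n = 0 := hn.left_eq_zero hef0
  have hnf : n * f = 0 := hn.right_eq_zero hef0
  have hmm : m * m = 0 := hm.mul_eq_zero hm hfe0
  have hnn : n * n = 0 := hn.mul_eq_zero hn hef0
  have h1 : (1 + m) * (1 - m) = 1 := by
    calc (1 + m) * (1 - m) = 1 - m * m := by noncomm_ring
      _ = 1 := by rw [hmm, sub_zero]
  have h2 : (1 + n) * (1 - n) = 1 := by
    calc (1 + n) * (1 - n) = 1 - n * n := by noncomm_ring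
      _ = 1 := by rw [hnn, sub_zero]
  have hp : (1 - n) * ((1 - m) * e * (1 + m)) * (1 + n)
      = e + m * n - n * m + (m - (n + n * m * n)) := by
    calc (1 - n) * ((1 - m) * e * (1 + m)) * (1 + n)
        = (1 - n) * (e + e * m - m * e - m * e * m) * (1 + n) := by noncomm_ring
      _ = (1 - n) * (e + m) * (1 + n) := by rw [hme, hm.1]; simp
      _ = e + m + e * n + m * n - n * e - n * m - n * e * n - n * m * n := by noncomm_ring
      _ = e + m + 0 + m * n - n - n * m - n * n - n * m * n := by rw [hen, hn.2]
      _ = _ := by rw [hnn]; noncomm_ring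
  have hidem : (e + m * n - n * m + (m - (n + n * m * n))) *
      (e + m * n - n * m + (m - (n + n * m * n)))
      = e + m * n - n * m + (m - (n + n * m * n)) := by
    rw [← hp]
    calc _ = (1 - n) * (1 - m) * e * (1 + m) * ((1 + n) * (1 - n)) * (1 - m) * e * (1 + m)
          * (1 + n) := by simp only [mul_assoc]
      _ = (1 - n) * (1 - m) * e * ((1 + m) * (1 - m)) * e * (1 + m) * (1 + n) := by
        rw [h2]; simp only [mul_assoc, one_mul]
      _ = (1 - n) * (1 - m) * (e * e) * (1 + m) * (1 + n) := by
        rw [h1]; simp only [mul_assoc, one_mul]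
      _ = _ := by rw [he]; simp only [mul_assoc]
  have hcomm := commute_of_iterComm_idempotent hidem k (hT _)
  have hz : T (e + m * n - n * m) ∈ Subring.center G := by
    rw [map_sub, map_add]
    exact sub_mem (add_mem (hcent _ (Or.inl ⟨he, he⟩)) (hcent _ (Or.inl (hm.mul hn))))
      (hcent _ (Or.inr (hn.mul hm)))
  rw [map_add, add_mul (T _) (T _), mul_add _ (T _) (T _), Subring.mem_center_iff.mp hz,
    add_right_inj] at hcomm
  have hc := hdiag (m - (n + n * m * n))
  have hcf := commute_of_compl hef hc
  have hpf : e * (e + m * n - n * m + (m - (n + n * m * n))) * f = m := by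
    calc e * (e + m * n - n * m + (m - (n + n * m * n))) * f
        = e * e * f + e * m * (n * f) - e * n * m * f + e * m * f - e * n * f
          - e * n * (m * n * f) := by noncomm_ring
      _ = m := by rw [hen, hnf, he, hef0, hm.1, hm.2]; simp
  have hfin : T (m - (n + n * m * n)) * m = m * T (m - (n + n * m * n)) := by
    generalize T (m - (n + n * m * n)) = D at hcomm hc hcf
    generalize e + m * n - n * m + (m - (n + n * m * n)) = p at hcomm hpf
    rw [← hpf]
    calc D * (e * p * f) = (D * e) * p * f := by noncomm_ring
      _ = e * (D * p) * f := by rw [hc]; noncomm_ring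
      _ = e * p * (D * f) := by rw [hcomm]; noncomm_ring
      _ = e * p * f * D := by rw [hcf]; noncomm_ring
  rw [map_sub, sub_mul, mul_sub, hTm, sub_right_inj] at hfin
  exact hfin

theorem commute_map_offdiag (htf : ∀ g : G, g + g = 0 → g = 0) (he : e * e = e)
    (hef : e + f = 1) (hT : ∀ g, iterComm k (T g) g = 0) (hdiag : ∀ g, T g * e = e * T g)
    (hcent : ∀ c, IsPeirce e e c ∨ IsPeirce f f c → T c ∈ Subring.center G) {m n : G}
    (hm : IsPeirce e f m) (hn : IsPeirce f e n) (hTm : T m * m = m * T m) :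
    T n * m = m * T n := by
  have h1 := commute_map_of_conj_idempotent he hef hT hdiag hcent hm hn hTm
  have h2 := commute_map_of_conj_idempotent he hef hT hdiag hcent hm (hn.add hn) hTm
  have h3 : (n + n) * m * (n + n) = n * m * n + n * m * n + (n * m * n + n * m * n) := by
    noncomm_ring
  rw [h3] at h2
  simp only [map_add] at h1 h2
  generalize T (n * m * n) = W at h1 h2
  have hW : W * m - m * W = 0 := by
    apply htf
    calc W * m - m * W + (W * m - m * W)
        = ((T n + T n + (W + W + (W + W))) * m - m * (T n + T n + (W + W + (W + W))))
          - ((T n + W) * m - m * (T n + W)) - ((T n + W) * m - m * (T n + W)) := by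
          noncomm_ring
      _ = 0 := by rw [h1, h2]; simp
  rwa [add_mul, mul_add, sub_eq_zero.mp hW, add_left_inj] at h1

theorem peirce_sum (hef : e + f = 1) (g : G) :
    g = e * g * e + e * g * f + f * g * e + f * g * f := by
  calc g = (e + f) * g * (e + f) := by rw [hef]; simp
    _ = _ := by noncomm_ring

end Peirce

section Core

variable {G : Type*} [Ring G] {e f : G} {k : ℕ} {T : G →+ G}

theorem exists_center_of_compress {p q : G} (hp : p * p = p) (hpq : p + q = 1)
    (hC : ∀ c, IsPeirce p p c → (∀ x, IsPeirce p p x → iterComm k c x = 0) →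
      ∃ z ∈ Subring.center G, c = p * z)
    (hT : ∀ g, iterComm k (T g) g = 0) {y : G} (hTy : T y * p = p * T y)
    (hy : p * y * p = 0) (hy' : p * y * q = 0 ∨ q * y * p = 0) :
    ∃ z ∈ Subring.center G, p * T y = p * z := by
  obtain ⟨z, hz, h⟩ := hC (p * T y * p) (isPeirce_mul_mul hp hp _) fun x hx =>
    iterComm_compress_map hp hpq hT hx (commute_map_of_isPeirce hp hpq hT hx) hTy hy hy'
  exact ⟨z, hz, by rw [← h, mul_assoc, hTy, ← mul_assoc, hp]⟩

/-- A `k`-commuting map which sends `e` to the center is central-valued. -/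
theorem map_mem_center_of_map_idempotent_mem_center (htf : ∀ g : G, g + g = 0 → g = 0)
    (he : e * e = e) (hef : e + f = 1)
    (hL : ∀ a : G, IsPeirce e e a → (∀ m, IsPeirce e f m → a * m = 0) → a = 0)
    (hR : ∀ b : G, IsPeirce f f b → (∀ m, IsPeirce e f m → m * b = 0) → b = 0)
    (hA : ∀ c, IsPeirce e e c → (∀ x, IsPeirce e e x → iterComm k c x = 0) →
      ∃ z ∈ Subring.center G, c = e * z)
    (hB : ∀ c, IsPeirce f f c → (∀ x, IsPeirce f f x → iterComm k c x = 0) →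
      ∃ z ∈ Subring.center G, c = f * z)
    (hZ : ∃ m0 n0, IsPeirce e f m0 ∧ IsPeirce f e n0 ∧ ∀ D, D * e = e * D →
      (∃ z ∈ Subring.center G, e * D = e * z) → (∃ z ∈ Subring.center G, f * D = f * z) →
      D * m0 = m0 * D → n0 * D = D * n0 → D ∈ Subring.center G)
    (hT : ∀ g, iterComm k (T g) g = 0) (hTe : T e ∈ Subring.center G) (g : G) :
    T g ∈ Subring.center G := by
  obtain ⟨hf, hef0, hfe0⟩ := compl_relations he hef
  have hfe : f + e = 1 := by rwa [add_comm]
  have hM : ∀ m, IsPeirce e f m → T m * m = m * T m ∧ T m * e = e * T m := fun m hm => by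
    obtain ⟨h1, h2⟩ := commute_map_of_offdiag htf he hT (u := m)
      (by rw [hm.1, hm.right_eq_zero hfe0, add_zero]) (hm.mul_eq_zero hm hfe0)
    rw [Subring.mem_center_iff.mp hTe m, sub_self, zero_add, sub_eq_zero] at h2
    exact ⟨h1, h2⟩
  have hN : ∀ n, IsPeirce f e n → T n * n = n * T n ∧ T n * e = e * T n := fun n hn => by
    obtain ⟨h1, h2⟩ := commute_map_of_offdiag htf he hT (u := n)
      (by rw [hn.2, hn.left_eq_zero hef0, zero_add]) (hn.mul_eq_zero hn hef0)
    rw [Subring.mem_center_iff.mp hTe n, sub_self, zero_add, sub_eq_zero] at h2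
    exact ⟨h1, h2⟩
  have hdiag : ∀ g, T g * e = e * T g := fun g => by
    rw [peirce_sum hef g]
    simp only [map_add, add_mul, mul_add]
    rw [commute_map_of_isPeirce_diag he hef hT (Or.inl (isPeirce_mul_mul he he g)),
      commute_map_of_isPeirce_diag he hef hT (Or.inr (isPeirce_mul_mul hf hf g)),
      (hM _ (isPeirce_mul_mul he hf g)).2, (hN _ (isPeirce_mul_mul hf he g)).2]
  have hdiagf : ∀ g, T g * f = f * T g := fun g => commute_of_compl hef (hdiag g)
  have hcomp_e : ∀ y, e * y * e = 0 → (e * y * f = 0 ∨ f * y * e = 0) →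
      ∃ z ∈ Subring.center G, e * T y = e * z := fun y =>
    exists_center_of_compress he hef hA hT (hdiag y)
  have hcomp_f : ∀ y, f * y * f = 0 → (f * y * e = 0 ∨ e * y * f = 0) →
      ∃ z ∈ Subring.center G, f * T y = f * z := fun y =>
    exists_center_of_compress hf hfe hB hT (hdiagf y)
  have hcent : ∀ c, IsPeirce e e c ∨ IsPeirce f f c → T c ∈ Subring.center G := fun c hc => by
    have hcm : ∀ m, IsPeirce e f m → T c * m = m * T c := fun m hm =>
      commute_map_diag_of_isPeirce htf he hef hT hdiag hc hm
    rcases hc with hc | hc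
    · have hfc : f * c = 0 := hc.left_eq_zero hfe0
      obtain ⟨z, hz, h⟩ := hcomp_f c (by rw [hfc, zero_mul]) (Or.inl (by rw [hfc, zero_mul]))
      exact mem_center_of_right hef hL he (hdiag c) hcm hz h
    · have hec : e * c = 0 := hc.left_eq_zero hef0
      obtain ⟨z, hz, h⟩ := hcomp_e c (by rw [hec, zero_mul]) (Or.inl (by rw [hec, zero_mul]))
      exact mem_center_of_left hef hR he (hdiag c) hcm hz h
  have hNcent : ∀ n, IsPeirce f e n → T n ∈ Subring.center G := fun n hn => by
    have hen : e * n = 0 := hn.left_eq_zero hef0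
    obtain ⟨z, hz, h⟩ := hcomp_e n (by rw [hen, zero_mul]) (Or.inl (by rw [hen, zero_mul]))
    exact mem_center_of_left hef hR he (hdiag n)
      (fun m hm => commute_map_offdiag htf he hef hT hdiag hcent hm hn (hM m hm).1) hz h
  have hMN : ∀ m n, IsPeirce e f m → IsPeirce f e n → T m * n = n * T m := fun m n hm hn =>
    commute_map_offdiag htf hf hfe hT hdiagf (fun c hc => hcent c hc.symm) hn hm (hN n hn).1
  have hMcent : ∀ m, IsPeirce e f m → T m ∈ Subring.center G := by
    obtain ⟨m0, n0, hm0, hn0, hZ⟩ := hZ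
    have key : ∀ m, IsPeirce e f m → T m * m0 = m0 * T m → T m ∈ Subring.center G := by
      intro m hm h
      have hfm : f * m = 0 := hm.left_eq_zero hfe0
      have hme : m * e = 0 := hm.right_eq_zero hfe0
      exact hZ _ (hdiag m)
        (hcomp_e m (by rw [mul_assoc, hme, mul_zero]) (Or.inr (by rw [hfm, zero_mul])))
        (hcomp_f m (by rw [hfm, zero_mul]) (Or.inl (by rw [hfm, zero_mul]))) h
        (hMN m n0 hm hn0).symm
    have hTm0 := Subring.mem_center_iff.mp (key m0 hm0 (hM m0 hm0).1)
    intro m hm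
    apply key m hm
    have h := (hM _ (hm.add hm0)).1
    rw [map_add, add_mul (T _) (T _), mul_add _ (T _) (T _), hTm0, add_left_inj, mul_add, add_mul,
      (hM m hm).1, add_right_inj] at h
    exact h
  rw [peirce_sum hef g]
  simp only [map_add]
  exact add_mem (add_mem (add_mem (hcent _ (Or.inl (isPeirce_mul_mul he he g)))
    (hMcent _ (isPeirce_mul_mul he hf g))) (hNcent _ (isPeirce_mul_mul hf he g)))
    (hcent _ (Or.inr (isPeirce_mul_mul hf hf g)))

/-- A `k`-commuting map agrees at `e` with a central multiple of `e`, modulo the center. -/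
theorem exists_center_map_idempotent_sub (he : e * e = e) (hef : e + f = 1)
    (hA : ∀ c, IsPeirce e e c → (∀ x, IsPeirce e e x → iterComm k c x = 0) →
      ∃ z ∈ Subring.center G, c = e * z)
    (hB : ∀ c, IsPeirce f f c → (∀ x, IsPeirce f f x → iterComm k c x = 0) →
      ∃ z ∈ Subring.center G, c = f * z)
    (hT : ∀ g, iterComm k (T g) g = 0) :
    ∃ l ∈ Subring.center G, T e - l * e ∈ Subring.center G := by
  obtain ⟨hf, hef0, hfe0⟩ := compl_relations he hef
  have hfe : f + e = 1 := by rwa [add_comm]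
  have hTe := commute_map_of_isPeirce he hef hT ⟨he, he⟩
  have hTf := commute_map_of_isPeirce_diag he hef hT (Or.inr ⟨hf, hf⟩)
  obtain ⟨w, hw, hTw⟩ := exists_center_of_compress hf hfe hB hT (commute_of_compl hef hTe)
    (by rw [hfe0, zero_mul]) (Or.inl (by rw [hfe0, zero_mul]))
  have hT1 : ∀ g, iterComm k (T 1) g = 0 := fun g => by
    have h := hT (g + 1)
    rwa [iterComm_add_one_right, map_add, iterComm_add, hT, zero_add] at h
  obtain ⟨z, hz, hTz⟩ := hA (e * T e * e) (isPeirce_mul_mul he he _) fun x hx => by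
    have h1 := iterComm_compress_map he hef hT hx (commute_map_of_isPeirce he hef hT hx) hTf
      (by rw [hef0, zero_mul]) (Or.inr (by rw [mul_assoc, hfe0, mul_zero]))
    have hT1e : T 1 * e = e * T 1 := by rw [← hef, map_add, add_mul, mul_add, hTe, hTf]
    have h2 := compress_iterComm_of_lower k (g := x) (x := T 1) he hef
      (by rw [hx.1, hx.right_eq_zero hef0]) (by rw [← hT1e, mul_assoc, hef0, mul_zero])
    rw [hT1, hx.1, hx.2, ← hef, map_add, mul_add, add_mul, iterComm_add, h1] at h2
    simpa using h2.symm
  have hTz' : e * T e = e * z := by rw [← hTz, mul_assoc, hTe, ← mul_assoc, he]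
  refine ⟨z - w, sub_mem hz hw, ?_⟩
  have hval : T e - (z - w) * e = w := by
    have h : T e = e * T e + f * T e := by rw [← add_mul, hef, one_mul]
    rw [h, hTz', hTw, sub_mul, ← Subring.mem_center_iff.mp hz e,
      ← Subring.mem_center_iff.mp hw e]
    calc e * z + f * w - (e * z - e * w) = (e + f) * w := by noncomm_ring
      _ = w := by rw [hef, one_mul]
  rwa [hval]

end Core

/-- main theorem: let `G` be a 2-torsion free generalized matrix algebra with
Peirce corners `A = eGe`, `B = fGf`, `M = eGf`, `N = fGe`. If
(1) `Z(A)_k = π_A(Z(G))`, (2) `Z(B)_k = π_B(Z(G))`, and (3) there exist `m0 ∈ M`, `n0 ∈ N`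
such that `Z(G) = {a + b : a ∈ Z(A), b ∈ Z(B), a m0 = m0 b, n0 a = b n0}`, then every
k-commuting `R`-linear map `Θ : G → G` is proper: `Θ(g) = λ g + ζ(g)` with `λ ∈ Z(G)` and
`ζ : G → Z(G)` an `R`-linear map. -/
theorem kCommuting_proper_of_conditions
    {R : Type*} [CommRing R] {G : Type*} [Ring G] [Algebra R G]
    (e : G) (he : e * e = e) (f : G) (hf : f = 1 - e)
    (hMN : (∃ m : G, m = e * m * f ∧ m ≠ 0) ∨ (∃ n : G, n = f * n * e ∧ n ≠ 0))
    (hMfaithL : ∀ a : G, a = e * a * e → (∀ m : G, m = e * m * f → a * m = 0) → a = 0)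
    (hMfaithR : ∀ b : G, b = f * b * f → (∀ m : G, m = e * m * f → m * b = 0) → b = 0)
    (htf : ∀ g : G, g + g = 0 → g = 0)
    (k : ℕ) (hk : 2 ≤ k)
    -- (1): Z(A)_k = π_A(Z(G))
    (hZAk : ∀ c : G,
      (c = e * c * e ∧ ∀ x : G, x = e * x * e → iterComm k c x = 0) ↔
      (∃ z : G, (∀ x : G, z * x = x * z) ∧ c = e * z * e))
    -- (2): Z(B)_k = π_B(Z(G))
    (hZBk : ∀ c : G,
      (c = f * c * f ∧ ∀ y : G, y = f * y * f → iterComm k c y = 0) ↔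
      (∃ z : G, (∀ x : G, z * x = x * z) ∧ c = f * z * f))
    -- (3): description of Z(G) via m0 and n0
    (hZG : ∃ m0 n0 : G, m0 = e * m0 * f ∧ n0 = f * n0 * e ∧
      ∀ z : G, (∀ x : G, z * x = x * z) ↔
        ∃ a b : G, (a = e * a * e ∧ ∀ x : G, x = e * x * e → a * x = x * a) ∧
          (b = f * b * f ∧ ∀ y : G, y = f * y * f → b * y = y * b) ∧
          a * m0 = m0 * b ∧ n0 * a = b * n0 ∧ z = a + b)
    (Θ : G →ₗ[R] G) (hΘ : ∀ g : G, iterComm k (Θ g) g = 0) :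
    ∃ lam : G, (∀ x : G, lam * x = x * lam) ∧
      ∃ ζ : G →ₗ[R] G, (∀ g x : G, ζ g * x = x * ζ g) ∧
        ∀ g : G, Θ g = lam * g + ζ g := by
  have hef : e + f = 1 := by rw [hf]; abel
  obtain ⟨hff, hef0, hfe0⟩ := compl_relations he hef
  have hcen : ∀ {z : G}, z ∈ Subring.center G ↔ ∀ x, z * x = x * z := fun {z} =>
    Subring.mem_center_iff.trans (forall_congr' fun _ => eq_comm)
  have hA : ∀ c, IsPeirce e e c → (∀ x, IsPeirce e e x → iterComm k c x = 0) →
      ∃ z ∈ Subring.center G, c = e * z := fun c hc h => by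
    obtain ⟨z, hz, hcz⟩ := (hZAk c).mp ⟨(isPeirce_iff he he).mp hc,
      fun x hx => h x ((isPeirce_iff he he).mpr hx)⟩
    exact ⟨z, hcen.mpr hz, by rw [hcz, mul_assoc, hz, ← mul_assoc, he]⟩
  have hB : ∀ c, IsPeirce f f c → (∀ x, IsPeirce f f x → iterComm k c x = 0) →
      ∃ z ∈ Subring.center G, c = f * z := fun c hc h => by
    obtain ⟨z, hz, hcz⟩ := (hZBk c).mp ⟨(isPeirce_iff hff hff).mp hc,
      fun x hx => h x ((isPeirce_iff hff hff).mpr hx)⟩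
    exact ⟨z, hcen.mpr hz, by rw [hcz, mul_assoc, hz, ← mul_assoc, hff]⟩
  have corner_comm : ∀ {p D z x : G}, p * p = p → z ∈ Subring.center G → D * p = p * D →
      p * D = p * z → x = p * x * p → p * D * x = x * (p * D) := by
    intro p D z x hp hz hD h hx
    have hx' := (isPeirce_iff hp hp).mpr hx
    have hz := Subring.mem_center_iff.mp hz
    rw [h, mul_assoc, ← hz x, ← mul_assoc, hx'.1, ← mul_assoc, hx'.2]
  have hZ : ∃ m0 n0, IsPeirce e f m0 ∧ IsPeirce f e n0 ∧ ∀ D, D * e = e * D →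
      (∃ z ∈ Subring.center G, e * D = e * z) → (∃ z ∈ Subring.center G, f * D = f * z) →
      D * m0 = m0 * D → n0 * D = D * n0 → D ∈ Subring.center G := by
    obtain ⟨m0, n0, hm0, hn0, hZ⟩ := hZG
    have hm0 := (isPeirce_iff he hff).mpr hm0
    have hn0 := (isPeirce_iff hff he).mpr hn0
    refine ⟨m0, n0, hm0, hn0, fun D hD ⟨z, hz, hDz⟩ ⟨w, hw, hDw⟩ hDm hDn => ?_⟩
    have hDf := commute_of_compl hef hD
    refine hcen.mpr ((hZ D).mpr ⟨e * D, f * D, ⟨?_, fun x hx => corner_comm he hz hD hDz hx⟩,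
      ⟨?_, fun x hx => corner_comm hff hw hDf hDw hx⟩, ?_, ?_, ?_⟩)
    · rw [mul_assoc, mul_assoc, hD, ← mul_assoc e e D, he, ← mul_assoc, he]
    · rw [mul_assoc, mul_assoc, hDf, ← mul_assoc f f D, hff, ← mul_assoc, hff]
    · rw [← hD, mul_assoc, hm0.1, ← mul_assoc, hm0.2, hDm]
    · rw [← mul_assoc, hn0.2, ← hDf, mul_assoc, hn0.1, hDn]
    · rw [← add_mul, hef, one_mul]
  obtain ⟨l, hl, hle⟩ :=
    exists_center_map_idempotent_sub (T := Θ.toAddMonoidHom) he hef hA hB hΘ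
  have hl' := hcen.mp hl
  have hTk : ∀ g, iterComm k ((Θ - LinearMap.mulLeft R l) g) g = 0 := fun g => by
    rw [LinearMap.sub_apply, LinearMap.mulLeft_apply, iterComm_sub, hΘ,
      iterComm_eq_zero_of_commute (by omega) (by rw [mul_assoc, hl' (g * g), mul_assoc, ← hl' g])]
    simp
  refine ⟨l, hl', Θ - LinearMap.mulLeft R l, fun g => hcen.mp ?_, fun g => by simp⟩
  exact map_mem_center_of_map_idempotent_mem_center
    (T := (Θ - LinearMap.mulLeft R l).toAddMonoidHom) htf he hef
    (fun a ha h => hMfaithL a ((isPeirce_iff he he).mp ha)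
      fun m hm => h m ((isPeirce_iff he hff).mpr hm))
    (fun b hb h => hMfaithR b ((isPeirce_iff hff hff).mp hb)
      fun m hm => h m ((isPeirce_iff he hff).mpr hm))
    hA hB hZ hTk hle g
end

section
/- Let R be a 2-torsion free commutative ring with identity and n ≥ 2 an integer. Then every k-commuting R-linear map of the algebra Tₙ(R) of n × n upper triangular matrices over R is proper; likewise, every k-commuting R-linear map of the algebra of n × n lower triangular matrices over R is proper. -/
/-- The algebra `Tₙ(R)` of `n × n` upper triangular matrices over `R`
(entries below the diagonal vanish), as a subalgebra of `Mₙ(R)`. -/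
def upperTriAlg (R : Type*) [CommRing R] (n : ℕ) :
    Subalgebra R (Matrix (Fin n) (Fin n) R) where
  carrier := {X | X.BlockTriangular (id : Fin n → Fin n)}
  mul_mem' := fun {a b} (ha : Matrix.BlockTriangular a id) (hb : Matrix.BlockTriangular b id) =>
    Matrix.BlockTriangular.mul ha hb
  add_mem' := fun {a b} (ha : Matrix.BlockTriangular a id) (hb : Matrix.BlockTriangular b id) =>
    Matrix.BlockTriangular.add ha hb
  algebraMap_mem' := fun r => by
    show Matrix.BlockTriangular _ id
    rw [Matrix.algebraMap_eq_diagonal]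
    exact Matrix.blockTriangular_diagonal _

/-- The algebra `Tₙ′(R)` of `n × n` lower triangular matrices over `R`
(entries above the diagonal vanish), as a subalgebra of `Mₙ(R)`. -/
def lowerTriAlg (R : Type*) [CommRing R] (n : ℕ) :
    Subalgebra R (Matrix (Fin n) (Fin n) R) where
  carrier := {X | X.BlockTriangular (OrderDual.toDual : Fin n → (Fin n)ᵒᵈ)}
  mul_mem' := fun {a b} (ha : Matrix.BlockTriangular a OrderDual.toDual)
      (hb : Matrix.BlockTriangular b OrderDual.toDual) =>
    Matrix.BlockTriangular.mul ha hb
  add_mem' := fun {a b} (ha : Matrix.BlockTriangular a OrderDual.toDual)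
      (hb : Matrix.BlockTriangular b OrderDual.toDual) =>
    Matrix.BlockTriangular.add ha hb
  algebraMap_mem' := fun r => by
    show Matrix.BlockTriangular _ OrderDual.toDual
    rw [Matrix.algebraMap_eq_diagonal]
    exact Matrix.blockTriangular_diagonal _

section KCommuting

open Matrix

/-- A `k`-fold commutator with an idempotent vanishes only if the simple commutator does. -/
lemma commute_of_iterComm_eq_zero {G : Type*} [Ring G] {x e : G} (he : e * e = e) :
    ∀ {k : ℕ}, iterComm (k + 1) x e = 0 → x * e = e * x
  | 0, h => sub_eq_zero.mp h
  | k + 1, h => by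
    refine commute_of_iterComm_eq_zero he (k := k) ?_
    change (iterComm k x e * e - e * iterComm k x e) * e -
      e * (iterComm k x e * e - e * iterComm k x e) = 0 at h
    change iterComm k x e * e - e * iterComm k x e = 0
    generalize iterComm k x e = y at h ⊢
    have hl : e * y = e * y * e := by
      have := congrArg (e * ·) h
      simp only [mul_sub, sub_mul, mul_zero, ← mul_assoc, he] at this
      simp only [mul_assoc, he] at this ⊢
      rw [← sub_eq_zero, ← this]
      abel
    have hr : y * e = e * y * e := by
      have := congrArg (· * e) h
      simp only [mul_sub, sub_mul, zero_mul, mul_assoc, he] at this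
      simp only [← mul_assoc, he] at this ⊢
      rw [← sub_eq_zero, ← this]
      abel
    rw [hl, hr, sub_self]

variable {R ι α : Type*} [CommRing R] [LinearOrder α]

/-- The polarization of `x ↦ [F x, x]`, as a bilinear map. -/
def polarComm {M : Type*} [Ring M] [Algebra R M] (F : M →ₗ[R] M) : M →ₗ[R] M →ₗ[R] M :=
  LinearMap.mk₂ R (fun x y => F x * y - y * F x + (F y * x - x * F y))
    (fun _ _ _ => by simp only [map_add]; noncomm_ring)
    (fun c x y => by simp only [map_smul, smul_mul_assoc, mul_smul_comm, smul_sub, smul_add])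
    (fun _ _ _ => by simp only [map_add]; noncomm_ring)
    (fun c x y => by simp only [map_smul, smul_mul_assoc, mul_smul_comm, smul_sub, smul_add])

lemma polarComm_apply {M : Type*} [Ring M] [Algebra R M] (F : M →ₗ[R] M) (x y : M) :
    polarComm F x y = F x * y - y * F x + (F y * x - x * F y) := rfl

lemma coe_iterComm {A : Type*} [Ring A] [Algebra R A] (S : Subalgebra R A) (k : ℕ) (x y : S) :
    ((iterComm k x y : S) : A) = iterComm k (x : A) (y : A) := by
  induction k with
  | zero => rfl
  | succ k ih => simp [iterComm, ih]

/-- The linear projection onto block triangular matrices. -/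
def blockTriangularPart (R : Type*) [CommRing R] (b : ι → α) :
    Matrix ι ι R →ₗ[R] Matrix ι ι R where
  toFun x := of fun i j => if b j < b i then 0 else x i j
  map_add' x y := by ext i j; by_cases h : b j < b i <;> simp [h]
  map_smul' c x := by ext i j; by_cases h : b j < b i <;> simp [h]

lemma blockTriangular_blockTriangularPart (b : ι → α) (x : Matrix ι ι R) :
    (blockTriangularPart R b x).BlockTriangular b :=
  fun _ _ h => if_pos h

lemma blockTriangularPart_of_blockTriangular {b : ι → α} {x : Matrix ι ι R}
    (hx : x.BlockTriangular b) : blockTriangularPart R b x = x := by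
  ext i j
  by_cases h : b j < b i
  · exact (if_pos h).trans (hx h).symm
  · exact if_neg h

variable [Fintype ι] [DecidableEq ι]

/-- A symmetric bilinear map that is isotropic on triangular idempotents vanishes on all pairs of
triangular matrix units. -/
lemma bilin_single_single_eq_zero {N : Type*} [AddCommGroup N] [Module R N]
    (htf : ∀ x : N, x + x = 0 → x = 0) {b : ι → α} (hb : b.Injective)
    (B : Matrix ι ι R →ₗ[R] Matrix ι ι R →ₗ[R] N) (hsymm : ∀ x y, B x y = B y x)
    (hidem : ∀ e : Matrix ι ι R, e.BlockTriangular b → e * e = e → B e e = 0)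
    {i j k l : ι} (hij : b i ≤ b j) (hkl : b k ≤ b l) :
    B (single i j 1) (single k l 1) = 0 := by
  have bt {i j : ι} (h : b i ≤ b j) := Matrix.blockTriangular_single h (1 : R)
  have polar {x y : Matrix ι ι R} (hx : B x x = 0) (hy : B y y = 0)
      (hxy : B (x + y) (x + y) = 0) : B x y = 0 := by
    refine htf _ ?_
    simpa [hx, hy, hsymm y x] using hxy
  have isotropic {e x : Matrix ι ι R} (he : B e e = 0) (hex : B e x = 0)
      (h : B (e + x) (e + x) = 0) : B x x = 0 := by
    simpa [he, hex, hsymm x e] using h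
  have polar' {x y : Matrix ι ι R} (hx : B x x = 0) (ha : B (x + y) (x + y) = 0)
      (hs : B (x - y) (x - y) = 0) : B y y = 0 ∧ B x y = 0 := by
    have hy : B y y = 0 := by
      refine htf _ ?_
      simp only [map_add, map_sub, LinearMap.add_apply, LinearMap.sub_apply, hx, hsymm y x]
        at ha hs
      have := congrArg₂ (· + ·) ha hs
      simp only [add_zero] at this
      rw [← this]
      abel
    exact ⟨hy, polar hx hy ha⟩
  have hd (i : ι) : B (single i i 1) (single i i 1) = 0 :=
    hidem _ (bt le_rfl) (by simp)
  have hdd (i j : ι) : B (single i i 1) (single j j 1) = 0 := by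
    by_cases h : i = j
    · rw [h, hd]
    · exact polar (hd i) (hd j) (hidem _ ((bt le_rfl).add (bt le_rfl))
        (by simp [mul_add, add_mul, h, Ne.symm h]))
  have hrow {i j : ι} (hij : b i ≤ b j) (h : i ≠ j) :
      B (single i j 1) (single i j 1) = 0 ∧ B (single i i 1) (single i j 1) = 0 :=
    polar' (hd i)
      (hidem _ ((bt le_rfl).add (bt hij)) (by simp [mul_add, add_mul, Ne.symm h]))
      (hidem _ ((bt le_rfl).sub (bt hij)) (by simp [mul_sub, sub_mul, Ne.symm h]))
  have hdo (l : ι) {i j : ι} (hij : b i ≤ b j) (h : i ≠ j) :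
      B (single l l 1) (single i j 1) = 0 := by
    by_cases hli : l = i
    · subst hli; exact (hrow hij h).2
    by_cases hlj : l = j
    · subst hlj
      exact polar (hd l) (hrow hij h).1
        (hidem _ ((bt le_rfl).add (bt hij)) (by simp [mul_add, add_mul, Ne.symm h]))
    · have := polar (x := single i i 1 + single l l 1) (y := single i j 1)
        (by simp [hd, hdd]) (hrow hij h).1
        (hidem _ (((bt le_rfl).add (bt le_rfl)).add (bt hij))
          (by simp [mul_add, add_mul, Ne.symm h, hli, Ne.symm hli, Ne.symm hlj]))
      simpa [(hrow hij h).2] using this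
  have hsep {i j k l : ι} (hij : b i ≤ b j) (hkl : b k ≤ b l) (h : i ≠ j) (h' : k ≠ l)
      (hil : i ≠ l) (hkj : k ≠ j) : B (single i j 1) (single k l 1) = 0 := by
    by_cases hik : i = k
    · subst hik
      have := hidem (single i i 1 + (single i j 1 + single i l 1))
        ((bt le_rfl).add ((bt hij).add (bt hkl)))
        (by simp [mul_add, add_mul, Ne.symm h, Ne.symm hil])
      exact polar (hrow hij h).1 (hrow hkl h').1
        (isotropic (hd i) (by simp [hdo i hij h, hdo i hkl hil]) this)
    · have := hidem (single i i 1 + single k k 1 + (single i j 1 + single k l 1))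
        (((bt le_rfl).add (bt le_rfl)).add ((bt hij).add (bt hkl)))
        (by simp [mul_add, add_mul, Ne.symm h, Ne.symm hil, Ne.symm h', Ne.symm hkj, hik,
          Ne.symm hik])
      have hz : B (single i i 1 + single k k 1) (single i j 1 + single k l 1) = 0 := by
        simp [hdo _ hij h, hdo _ hkl h']
      exact polar (hrow hij h).1 (hrow hkl h').1 (isotropic (by simp [hd, hdd]) hz this)
  have hchain {i j l : ι} (hij : b i ≤ b j) (hjl : b j ≤ b l) (h : i ≠ j) (h' : j ≠ l) :
      B (single i j 1) (single j l 1) = 0 := by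
    have hil : i ≠ l := fun hil => h (hb (le_antisymm hij (hil ▸ hjl)))
    have hil' := hij.trans hjl
    have := hidem (single j j 1 + single i l 1 + (single i j 1 + single j l 1))
      (((bt le_rfl).add (bt hil')).add ((bt hij).add (bt hjl)))
      (by
        simp [mul_add, add_mul, Ne.symm h, Ne.symm hil, Ne.symm h']
        abel)
    have hz : B (single j j 1 + single i l 1) (single i j 1 + single j l 1) = 0 := by
      simp [hdo _ hij h, hdo _ hjl h', hsep hil' hij hil h h hil,
        hsep hil' hjl hil h' hil h']
    exact polar (hrow hij h).1 (hrow hjl h').1 (isotropic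
      (by simp [hd, hdo _ hil' hil, hsymm (single i l 1) (single j j 1), (hrow hil' hil).1])
      hz this)
  by_cases h : i = j
  · subst h
    by_cases h' : k = l
    · subst h'; exact hdd i k
    · exact hdo i hkl h'
  by_cases h' : k = l
  · subst h'; rw [hsymm]; exact hdo k hij h
  by_cases hkj : k = j
  · subst hkj; exact hchain hij hkl h h'
  by_cases hil : i = l
  · subst hil; rw [hsymm]; exact hchain hkl hij h' h
  exact hsep hij hkl h h' hil hkj

lemma bilin_eq_zero_of_blockTriangular {N : Type*} [AddCommGroup N] [Module R N] {b : ι → α}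
    (B : Matrix ι ι R →ₗ[R] Matrix ι ι R →ₗ[R] N)
    (h : ∀ i j k l, b i ≤ b j → b k ≤ b l → B (single i j 1) (single k l 1) = 0)
    {x y : Matrix ι ι R} (hx : x.BlockTriangular b) (hy : y.BlockTriangular b) : B x y = 0 := by
  have key (f : Matrix ι ι R →ₗ[R] N)
      (hf : ∀ i j, b i ≤ b j → f (single i j 1) = 0) {z : Matrix ι ι R}
      (hz : z.BlockTriangular b) : f z = 0 := by
    rw [matrix_eq_sum_single z, map_sum]
    refine Finset.sum_eq_zero fun i _ => ?_
    rw [map_sum]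
    refine Finset.sum_eq_zero fun j _ => ?_
    rcases le_or_gt (b i) (b j) with hij | hij
    · rw [← mul_one (z i j), ← smul_eq_mul, ← smul_single, map_smul, hf i j hij, smul_zero]
    · rw [hz hij, single_zero, map_zero]
  refine key (B x) (fun k l hkl => ?_) hy
  exact key (B.flip (single k l 1)) (fun i j hij => h i j k l hij hkl) hx

/-- A linear map whose polarized commutator vanishes on triangular matrices is there a scalar
multiple of the identity plus a scalar-valued map. -/
lemma exists_eq_smul_add_smul_one [Nontrivial ι] (htf : ∀ r : R, r + r = 0 → r = 0)
    {b : ι → α} (F : Matrix ι ι R →ₗ[R] Matrix ι ι R)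
    (hB : ∀ x y : Matrix ι ι R, x.BlockTriangular b → y.BlockTriangular b →
      polarComm F x y = 0) :
    ∃ c : R, ∀ x : Matrix ι ι R, x.BlockTriangular b → ∃ d : R, F x = c • x + d • 1 := by
  have bt {i j : ι} (h : b i ≤ b j) := Matrix.blockTriangular_single h (1 : R)
  have entry {i : ι} {y : Matrix ι ι R} (hy : y.BlockTriangular b) (r s : ι) :
      (F (single i i 1) * y - y * F (single i i 1) : Matrix ι ι R) r s +
        (F y * single i i 1 - single i i 1 * F y : Matrix ι ι R) r s = 0 :=
    congrFun₂ (hB _ y (bt le_rfl) hy) r s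
  have hdiag_row (i s : ι) (h : i ≠ s) : F (single i i 1) i s = 0 ∧ F (single i i 1) s i = 0 := by
    constructor
    · have := entry (i := i) (bt (le_refl (b i))) i s
      simp [Ne.symm h] at this
      exact htf _ (by linear_combination -this)
    · have := entry (i := i) (bt (le_refl (b i))) s i
      simp [Ne.symm h] at this
      exact htf _ (by linear_combination this)
  have hoff (i r s : ι) (h : r ≠ s) : F (single i i 1) r s = 0 := by
    by_cases hr : r = i
    · subst hr; exact (hdiag_row r s h).1
    by_cases hs : s = i
    · subst hs; exact (hdiag_row s r h.symm).2
    have := entry (i := i) (bt (le_refl (b s))) r s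
    simpa [h, Ne.symm h, hr, hs, Ne.symm hr, Ne.symm hs] using this
  have hA (i : ι) : F (single i i 1) = diagonal fun r => F (single i i 1) r r := by
    ext r s
    by_cases h : r = s
    · subst h; simp
    · rw [hoff i r s h, diagonal_apply_ne _ h]
  have hconst_lt {i p q : ι} (hp : p ≠ i) (hq : q ≠ i) (hpq : b p ≤ b q) :
      F (single i i 1) p p = F (single i i 1) q q := by
    have := entry (i := i) (bt hpq) p q
    simp [hp, hq] at this
    linear_combination this
  have hconst {i p q : ι} (hp : p ≠ i) (hq : q ≠ i) :
      F (single i i 1) p p = F (single i i 1) q q := by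
    rcases le_total (b p) (b q) with h | h
    · exact hconst_lt hp hq h
    · exact (hconst_lt hq hp h).symm
  have hrow {i s : ι} (h : i ≠ s) {y : Matrix ι ι R} (hy : y.BlockTriangular b) :
      F y i s = (F (single i i 1) i i - F (single i i 1) s s) * y i s := by
    have := entry (i := i) hy i s
    rw [hA i] at this
    simp [Ne.symm h] at this
    linear_combination -this
  have hcol {i s : ι} (h : i ≠ s) {y : Matrix ι ι R} (hy : y.BlockTriangular b) :
      F y s i = (F (single i i 1) i i - F (single i i 1) s s) * y s i := by
    have := entry (i := i) hy s i
    rw [hA i] at this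
    simp [Ne.symm h] at this
    linear_combination this
  have hswap_lt {i s : ι} (h : i ≠ s) (his : b i ≤ b s) :
      F (single i i 1) i i - F (single i i 1) s s =
        F (single s s 1) s s - F (single s s 1) i i := by
    have := (hrow h (bt his)).symm.trans (hcol h.symm (bt his))
    simpa using this
  have hswap {i s : ι} (h : i ≠ s) :
      F (single i i 1) i i - F (single i i 1) s s =
        F (single s s 1) s s - F (single s s 1) i i := by
    rcases le_total (b i) (b s) with h' | h'
    · exact hswap_lt h h'
    · exact (hswap_lt h.symm h').symm
  obtain ⟨i₀, j₀, h₀⟩ := exists_pair_ne ι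
  obtain ⟨c, hc⟩ : ∃ c, c = F (single i₀ i₀ 1) i₀ i₀ - F (single i₀ i₀ 1) j₀ j₀ := ⟨_, rfl⟩
  have hcc {i s : ι} (h : i ≠ s) : F (single i i 1) i i - F (single i i 1) s s = c := by
    rw [hc]
    by_cases hi : i = i₀
    · subst hi; rw [hconst h.symm h₀.symm]
    · rw [hconst h.symm (Ne.symm hi), hswap hi, hconst hi h₀.symm]
  have hD {x : Matrix ι ι R} (hx : x.BlockTriangular b) :
      F x = c • x + diagonal fun r => F x r r - c * x r r := by
    ext r s
    by_cases h : r = s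
    · subst h; simp
    · simp [diagonal_apply_ne _ h, hrow h hx, hcc h]
  have hpair {x : Matrix ι ι R} (hx : x.BlockTriangular b) {p q : ι} (h : p ≠ q)
      (hpq : b p ≤ b q) : F x p p - c * x p p = F x q q - c * x q q := by
    have gen {y : Matrix ι ι R} (hy : y.BlockTriangular b) :
        (F y p p - c * y p p) - (F y q q - c * y q q) +
          ((F (single p q 1) p p) - (F (single p q 1) q q)) * y p q = 0 := by
      have := congrFun₂ (hB y _ hy (bt hpq)) p q
      rw [polarComm_apply, hD hy, hD (bt hpq)] at this
      simp [h, Ne.symm h, add_mul, mul_add] at this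
      linear_combination this
    have h1 := gen (bt hpq)
    simp [h, Ne.symm h] at h1
    have h2 := gen hx
    rw [htf _ h1] at h2
    linear_combination h2
  refine ⟨c, fun x hx => ⟨F x i₀ i₀ - c * x i₀ i₀, (hD hx).trans ?_⟩⟩
  rw [smul_one_eq_diagonal]
  congr 2
  funext r
  by_cases h : r = i₀
  · rw [h]
  · rcases le_total (b r) (b i₀) with hle | hle
    · exact hpair hx h hle
    · exact (hpair hx (Ne.symm h) hle).symm

/-- Every `k`-commuting linear map of the algebra of matrices that are triangular with respect to
an injective labelling of the indices is proper. -/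
lemma kCommuting_blockTriangular_proper_s14 [Nontrivial ι] (htf : ∀ r : R, r + r = 0 → r = 0)
    {b : ι → α} (hb : b.Injective) (S : Subalgebra R (Matrix ι ι R))
    (hS : ∀ x, x ∈ S ↔ x.BlockTriangular b) {k : ℕ} (hk : k ≠ 0) (Θ : S →ₗ[R] S)
    (hΘ : ∀ x, iterComm k (Θ x) x = 0) :
    ∃ lam : S, (∀ x, lam * x = x * lam) ∧ ∃ ζ : S →ₗ[R] S,
      (∀ x y, ζ x * y = y * ζ x) ∧ ∀ x, Θ x = lam * x + ζ x := by
  obtain ⟨k, rfl⟩ := Nat.exists_eq_succ_of_ne_zero hk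
  let P : Matrix ι ι R →ₗ[R] S := (blockTriangularPart R b).codRestrict S.toSubmodule
    fun x => (hS _).2 (blockTriangular_blockTriangularPart b x)
  let F : Matrix ι ι R →ₗ[R] Matrix ι ι R := S.val.toLinearMap ∘ₗ Θ ∘ₗ P
  have hFS (x : S) : F x = Θ x := by
    have : P x = x := Subtype.ext (blockTriangularPart_of_blockTriangular ((hS _).1 x.2))
    change ((Θ (P x) : S) : Matrix ι ι R) = _
    rw [this]
  have hidem (e : Matrix ι ι R) (he : e.BlockTriangular b) (hee : e * e = e) :
      polarComm F e e = 0 := by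
    have := congrArg (Subtype.val : S → Matrix ι ι R) (hΘ ⟨e, (hS e).2 he⟩)
    rw [coe_iterComm, ← hFS] at this
    rw [polarComm_apply, commute_of_iterComm_eq_zero hee this, sub_self, add_zero]
  have htfM (x : Matrix ι ι R) (hx : x + x = 0) : x = 0 := by
    ext i j
    exact htf _ (congrFun₂ hx i j)
  have hsymm (x y : Matrix ι ι R) : polarComm F x y = polarComm F y x := by
    rw [polarComm_apply, polarComm_apply, add_comm]
  obtain ⟨c, hc⟩ := exists_eq_smul_add_smul_one htf F
    fun x y hx hy => bilin_eq_zero_of_blockTriangular (polarComm F)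
      (fun _ _ _ _ => bilin_single_single_eq_zero htfM hb _ hsymm hidem) hx hy
  refine ⟨algebraMap R S c, fun x => Algebra.commutes c x, Θ - c • LinearMap.id,
    fun x y => ?_, fun x => ?_⟩
  · obtain ⟨d, hd⟩ := hc x ((hS _).1 x.2)
    have : (Θ - c • LinearMap.id : S →ₗ[R] S) x = algebraMap R S d := by
      refine Subtype.ext ?_
      rw [hFS] at hd
      simp [hd, Algebra.algebraMap_eq_smul_one]
    rw [this, Algebra.commutes]
  · simp [Algebra.algebraMap_eq_smul_one]

end KCommuting

/-- over a 2-torsion free commutative ring `R` with identity and `n ≥ 2`,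
every k-commuting `R`-linear map of the upper triangular matrix algebra `Tₙ(R)` is proper,
and likewise for the lower triangular matrix algebra. -/
theorem kCommuting_triangular_matrix_proper
    {R : Type*} [CommRing R] (htf : ∀ r : R, r + r = 0 → r = 0)
    (n : ℕ) (hn : 2 ≤ n) (k : ℕ) (hk : 2 ≤ k) :
    (∀ Θ : upperTriAlg R n →ₗ[R] upperTriAlg R n,
      (∀ X : upperTriAlg R n, iterComm k (Θ X) X = 0) →
      ∃ lam : upperTriAlg R n, (∀ X, lam * X = X * lam) ∧
        ∃ ζ : upperTriAlg R n →ₗ[R] upperTriAlg R n,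
          (∀ X Y, ζ X * Y = Y * ζ X) ∧ ∀ X, Θ X = lam * X + ζ X) ∧
    (∀ Θ : lowerTriAlg R n →ₗ[R] lowerTriAlg R n,
      (∀ X : lowerTriAlg R n, iterComm k (Θ X) X = 0) →
      ∃ lam : lowerTriAlg R n, (∀ X, lam * X = X * lam) ∧
        ∃ ζ : lowerTriAlg R n →ₗ[R] lowerTriAlg R n,
          (∀ X Y, ζ X * Y = Y * ζ X) ∧ ∀ X, Θ X = lam * X + ζ X) := by
  have : Nontrivial (Fin n) := Fin.nontrivial_iff_two_le.2 hn
  exact ⟨kCommuting_blockTriangular_proper_s14 htf Function.injective_id _ (fun _ => Iff.rfl) (by omega),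
    kCommuting_blockTriangular_proper_s14 htf OrderDual.toDual.injective _ (fun _ => Iff.rfl)
      (by omega)⟩
end

section
/- Let 𝒩 be a nest on a complex Hilbert space H. Then every k-commuting ℂ-linear map Θ: τ(𝒩) → τ(𝒩) of the nest algebra τ(𝒩) is proper, i.e., there exist λ ∈ Z(τ(𝒩)) and a ℂ-linear map ζ: τ(𝒩) → Z(τ(𝒩)) such that Θ(T) = λT + ζ(T) for all T ∈ τ(𝒩). -/
/-- The nest algebra `τ(𝒩) = {T ∈ B(H) : T(N) ⊆ N for all N ∈ 𝒩}`, as a subalgebra of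
the algebra `B(H) = H →L[ℂ] H` of bounded operators. -/
def nestAlg {H : Type*} [NormedAddCommGroup H] [InnerProductSpace ℂ H]
    (𝒩 : Set (Submodule ℂ H)) : Subalgebra ℂ (H →L[ℂ] H) where
  carrier := {T | ∀ N ∈ 𝒩, ∀ x ∈ N, T x ∈ N}
  mul_mem' := by
    intro a b ha hb N hN x hx
    exact ha N hN _ (hb N hN x hx)
  add_mem' := by
    intro a b ha hb N hN x hx
    simpa using N.add_mem (ha N hN x hx) (hb N hN x hx)
  algebraMap_mem' := by
    intro c N hN x hx
    simp only [Algebra.algebraMap_eq_smul_one, ContinuousLinearMap.smul_apply,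
      ContinuousLinearMap.one_apply]
    exact N.smul_mem c hx

set_option synthInstance.maxHeartbeats 1000000
set_option maxHeartbeats 2000000

section Ring

variable {R : Type*} [Ring R]

theorem commutator_eq_zero_of_idempotent {r w : R} (hr : r * r = r)
    (h : (w * r - r * w) * r - r * (w * r - r * w) = 0) : w * r = r * w := by
  have hr' (x : R) : r * (r * x) = r * x := by rw [← mul_assoc, hr]
  simp only [mul_sub, sub_mul, mul_assoc, hr, hr'] at h
  have h1 := congrArg (r * ·) h
  have h2 := congrArg (· * r) h
  simp only [mul_sub, sub_mul, mul_assoc, hr, hr', mul_zero, zero_mul] at h1 h2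
  linear_combination (norm := noncomm_ring) h2 - h1

theorem iterComm_idempotent {r w : R} (hr : r * r = r) {n : ℕ}
    (h : iterComm (n + 1) w r = 0) : w * r = r * w := by
  induction n with
  | zero => exact sub_eq_zero.1 h
  | succ n ih => exact ih (sub_eq_zero.2 (commutator_eq_zero_of_idempotent hr h))

theorem iterComm_sub_of_commute {x y c : R} (hc : c * y = y * c) (n : ℕ) :
    iterComm (n + 1) (x - c) y = iterComm (n + 1) x y := by
  induction n with
  | zero => simp only [iterComm]; linear_combination (norm := noncomm_ring) -hc
  | succ n ih => rw [iterComm, ih, ← iterComm]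

theorem iterComm_eq_zero_of_commute_s16 {x y : R} (hc : x * y = y * x) (n : ℕ) :
    iterComm (n + 1) x y = 0 := by
  induction n with
  | zero => simp [iterComm, hc]
  | succ n ih => rw [iterComm, ih]; simp

end Ring

theorem hasDerivAt_iterComm {R : Type*} [NormedRing R] [NormedAlgebra ℂ R] {x r : R}
    (hc : x * r = r * x) (y s : R) (n : ℕ) :
    HasDerivAt (fun t : ℂ => iterComm (n + 1) (x + t • y) (r + t • s))
      (iterComm n (y * r - r * y + (x * s - s * x)) r) 0 := by
  have hx (x y : R) : HasDerivAt (fun t : ℂ => x + t • y) y 0 := by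
    simpa using ((hasDerivAt_id (0 : ℂ)).smul_const y).const_add x
  induction n with
  | zero =>
    refine (((hx x y).mul (hx r s)).sub ((hx r s).mul (hx x y))).congr_deriv ?_
    simp only [iterComm, zero_smul, add_zero]
    abel
  | succ n ih =>
    refine ((ih.mul (hx r s)).sub ((hx r s).mul ih)).congr_deriv ?_
    simp only [zero_smul, add_zero, iterComm_eq_zero_of_commute_s16 hc]
    simp [iterComm]

section NormedAlgebra

variable {R : Type*} [NormedRing R] [NormedAlgebra ℂ R]

theorem kCommuting_linearize {k : ℕ} (hk : 2 ≤ k) {f : R →ₗ[ℂ] R}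
    (hf : ∀ x, iterComm k (f x) x = 0) {r : R} (hr : r * r = r) (s : R) :
    f r * r = r * f r ∧ (f s * r - r * f s + (f r * s - s * f r)) * r =
      r * (f s * r - r * f s + (f r * s - s * f r)) := by
  obtain ⟨n, rfl⟩ := Nat.exists_eq_add_of_le' hk
  have hc := iterComm_idempotent hr (hf r)
  refine ⟨hc, iterComm_idempotent (n := n) hr ?_⟩
  refine (hasDerivAt_iterComm hc (f s) s (n + 1)).unique ?_
  refine (hasDerivAt_const (0 : ℂ) (0 : R)).congr_of_eventuallyEq (.of_forall fun t => ?_)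
  simpa using hf (r + t • s)

/-- Elements of the corner `eRe` commuting with the idempotents of the corner are scalar. -/
def IsScalarCorner (e : R) : Prop :=
  ∀ c, e * c = c → c * e = c → (∀ r, r * r = r → e * r = r → r * e = r → c * r = r * c) →
    ∃ α : ℂ, c = α • e

theorem exists_smul_add_of_commute {e : R} (he : e * e = e) (h₁ : IsScalarCorner e)
    (h₂ : IsScalarCorner (1 - e)) {c : R} (hc : c * e = e * c)
    (hr : ∀ r, r * r = r → r * e = e * r → c * r = r * c) :
    ∃ α β : ℂ, c = α • e + β • (1 - e) := by
  obtain ⟨α, hα⟩ := h₁ (e * c) (by rw [← mul_assoc, he]) (by rw [mul_assoc, hc, ← mul_assoc, he])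
    fun r hrr h h' => by
      rw [mul_assoc, hr r hrr (h'.trans h.symm), ← mul_assoc, h, ← mul_assoc, h']
  have he' : (1 - e) * (1 - e) = 1 - e := by linear_combination (norm := noncomm_ring) he
  have hc' : c * (1 - e) = (1 - e) * c := by linear_combination (norm := noncomm_ring) -hc
  obtain ⟨β, hβ⟩ := h₂ ((1 - e) * c) (by rw [← mul_assoc, he'])
    (by rw [mul_assoc, hc', ← mul_assoc, he'])
    fun r hrr h h' => by
      rw [mul_assoc, hr r hrr (by linear_combination (norm := noncomm_ring) h - h'),
        ← mul_assoc, h, ← mul_assoc, h']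
  exact ⟨α, β, by rw [← hα, ← hβ]; noncomm_ring⟩

theorem kCommuting_commute_of_commute {k : ℕ} (hk : 2 ≤ k) {f : R →ₗ[ℂ] R}
    (hf : ∀ x, iterComm k (f x) x = 0) {r s : R} (hr : r * r = r) (hs : s * r = r * s) :
    f s * r = r * f s := by
  obtain ⟨h0, h⟩ := kCommuting_linearize hk hf hr s
  refine commutator_eq_zero_of_idempotent hr ?_
  have h1 : (f r * s - s * f r) * r = r * (f r * s - s * f r) := by
    linear_combination (norm := noncomm_ring) f r * hs + h0 * s - s * h0 - hs * f r
  linear_combination (norm := noncomm_ring) h - h1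

theorem kCommuting_scalar_of_apply_idempotent {k : ℕ} (hk : 2 ≤ k) {f : R →ₗ[ℂ] R}
    (hf : ∀ x, iterComm k (f x) x = 0) {e : R} (he : e * e = e)
    (h₁ : IsScalarCorner e) (h₂ : IsScalarCorner (1 - e))
    (hM : ∀ c, c * e = e * c → (∀ z, e * z = z → z * e = 0 → c * z = z * c) →
      ∃ α : ℂ, c = α • (1 : R))
    {β : ℂ} (hfe : f e = β • (1 : R)) (x : R) : ∃ α : ℂ, f x = α • (1 : R) := by
  have hcomm (s : R) : f s * e = e * f s := by
    have h := (kCommuting_linearize hk hf he s).2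
    rw [hfe] at h
    exact commutator_eq_zero_of_idempotent he (by simpa [sub_eq_zero] using h)
  have hself {z : R} (hz : e * z + z * e = z) (hzz : z * z = 0) : f z * z = z * f z := by
    have hr : (e + z) * (e + z) = e + z := by
      linear_combination (norm := noncomm_ring) he + hz + hzz
    have h := (kCommuting_linearize hk hf hr e).1
    rw [map_add, hfe] at h
    simp only [add_mul, mul_add, smul_mul_assoc, mul_smul_comm, one_mul, mul_one] at h
    linear_combination (norm := module) h - hcomm z
  have hdiag {s : R} (hs : s * e = e * s) : ∃ α : ℂ, f s = α • (1 : R) := by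
    refine hM _ (hcomm s) fun z hz hz' => ?_
    have hzz : z * z = 0 := by rw [← hz, mul_assoc e z, ← mul_assoc z e, hz']; simp
    have hr : (e + z) * (e + z) = e + z := by
      linear_combination (norm := noncomm_ring) he + hz + hz' + hzz
    have hr' : (e - z) * (e - z) = e - z := by
      linear_combination (norm := noncomm_ring) he - hz - hz' + hzz
    have h := (kCommuting_linearize hk hf hr s).2
    have h' := (kCommuting_linearize hk hf hr' s).2
    rw [map_add, hfe] at h
    rw [map_sub, hfe] at h'
    have hβ : (β • 1 + f z) * s - s * (β • 1 + f z) = f z * s - s * f z := by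
      simp [add_mul, mul_add]
    have hβ' : (β • 1 - f z) * s - s * (β • 1 - f z) = s * f z - f z * s := by
      simp [sub_mul, mul_sub]
    have hfs := hcomm s
    have hs₁ : f s * (e + z) - (e + z) * f s = f s * z - z * f s := by
      linear_combination (norm := noncomm_ring) hfs
    have hs₂ : f s * (e - z) - (e - z) * f s = z * f s - f s * z := by
      linear_combination (norm := noncomm_ring) hfs
    rw [hβ, hs₁] at h
    rw [hβ', hs₂] at h'
    have hfz := hcomm z
    have hw : f s * z * e - z * f s * e = 0 := by
      linear_combination (norm := noncomm_ring) f s * hz' - z * hfs - hz' * f s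
    have hw' : e * (f s * z - z * f s) = f s * z - z * f s := by
      linear_combination (norm := noncomm_ring) f s * hz - hfs * z - hz * f s
    have hc : (f z * s - s * f z) * e = e * (f z * s - s * f z) := by
      linear_combination (norm := noncomm_ring) f z * hs + hfz * s - s * hfz - hs * f z
    have h2 : (2 : ℂ) • (f s * z - z * f s) = 0 := by
      rw [two_smul]
      linear_combination (norm := noncomm_ring)
        h' - h + 2 * hc + 2 * hw - 2 * hw'
    exact sub_eq_zero.1 ((smul_eq_zero.1 h2).resolve_left two_ne_zero)
  have hoff {z : R} (hz : e * z + z * e = z) (hzz : z * z = 0) :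
      ∃ α : ℂ, f z = α • (1 : R) := by
    obtain ⟨α, β, h⟩ := exists_smul_add_of_commute he h₁ h₂ (hcomm z) fun r hr hre => by
      have h := (kCommuting_linearize hk hf hr z).2
      obtain ⟨γ, hγ⟩ := hdiag hre
      rw [hγ] at h
      exact commutator_eq_zero_of_idempotent hr (by simpa [sub_eq_zero] using h)
    by_cases hαβ : α = β
    · exact ⟨β, by rw [h, hαβ, ← smul_add]; simp⟩
    · have h' := hself hz hzz
      rw [h] at h'
      simp only [add_mul, mul_add, sub_mul, mul_sub, smul_mul_assoc, mul_smul_comm, one_mul,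
        mul_one] at h'
      have h2 : (α - β) • (e * z - z * e) = 0 := by linear_combination (norm := module) h'
      have hez : e * z = z * e :=
        sub_eq_zero.1 ((smul_eq_zero.1 h2).resolve_left (sub_ne_zero.2 hαβ))
      have heze : e * z * e = 0 := by linear_combination (norm := noncomm_ring) e * hz - he * z
      have h0 : e * z = 0 := by linear_combination (norm := noncomm_ring) heze + e * hez - he * z
      have hz0 : z = 0 := by rw [← hz, ← hez, h0, add_zero]
      exact ⟨0, by simp [hz0]⟩
  have he1 : e * (1 - e) = 0 := by rw [mul_sub, he, mul_one, sub_self]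
  have he2 : (1 - e) * e = 0 := by rw [sub_mul, he, one_mul, sub_self]
  have hx : x = (e * x * e + (1 - e) * x * (1 - e)) + e * x * (1 - e) + (1 - e) * x * e := by
    noncomm_ring
  obtain ⟨a, ha⟩ := hdiag (s := e * x * e + (1 - e) * x * (1 - e)) (by
    linear_combination (norm := noncomm_ring)
      e * x * he - he * x * e + (1 - e) * x * he2 - he1 * x * (1 - e))
  obtain ⟨b, hb⟩ := hoff (z := e * x * (1 - e))
    (by linear_combination (norm := noncomm_ring) he * x * (1 - e) + e * x * he2)
    (by linear_combination (norm := noncomm_ring) e * x * he2 * x * (1 - e))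
  obtain ⟨c, hc⟩ := hoff (z := (1 - e) * x * e)
    (by linear_combination (norm := noncomm_ring) he1 * x * e + (1 - e) * x * he)
    (by linear_combination (norm := noncomm_ring) (1 - e) * x * he1 * x * e)
  exact ⟨a + b + c, by rw [hx, map_add, map_add, ha, hb, hc, add_smul, add_smul]⟩

theorem kCommuting_proper_of_idempotent {k : ℕ} (hk : 2 ≤ k) {f : R →ₗ[ℂ] R}
    (hf : ∀ x, iterComm k (f x) x = 0) {e : R} (he : e * e = e)
    (h₁ : IsScalarCorner e) (h₂ : IsScalarCorner (1 - e))
    (hM : ∀ c, c * e = e * c → (∀ z, e * z = z → z * e = 0 → c * z = z * c) →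
      ∃ α : ℂ, c = α • (1 : R)) :
    ∃ l : ℂ, ∀ x, ∃ α : ℂ, f x - l • x = α • (1 : R) := by
  obtain ⟨α, β, h⟩ := exists_smul_add_of_commute he h₁ h₂
    (kCommuting_commute_of_commute hk hf he rfl) fun r hr hre =>
      kCommuting_commute_of_commute hk hf hr hre.symm
  obtain ⟨n, rfl⟩ := Nat.exists_eq_add_of_le' hk
  refine ⟨α - β, fun x => ?_⟩
  refine kCommuting_scalar_of_apply_idempotent hk (f := f - (α - β) • LinearMap.id) (fun x => ?_)
    he h₁ h₂ hM (β := β) ?_ x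
  · simp only [LinearMap.sub_apply, LinearMap.smul_apply, LinearMap.id_apply]
    rw [iterComm_sub_of_commute (by simp), hf]
  · simp only [LinearMap.sub_apply, LinearMap.smul_apply, LinearMap.id_apply, h]
    module
end NormedAlgebra

section Operators

variable {H : Type*} [NormedAddCommGroup H] [InnerProductSpace ℂ H]

theorem exists_smul_of_intertwines {F G a b : H →L[ℂ] H} (hF : F ≠ 0) (hG : G ≠ 0)
    (h : ∀ z, a * (F * z * G) = F * z * G * b) : ∃ c : ℂ, a * F = c • F ∧ G * b = c • G := by
  obtain ⟨u, hu⟩ : ∃ u, G u ≠ 0 := by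
    by_contra! h; exact hG (ContinuousLinearMap.ext h)
  obtain ⟨v, hv⟩ : ∃ v, F v ≠ 0 := by
    by_contra! h; exact hF (ContinuousLinearMap.ext h)
  obtain ⟨f, hf⟩ := SeparatingDual.exists_eq_one (R := ℂ) hu
  have key (g : H →L[ℂ] ℂ) (x y : H) : g (G y) • a (F x) = g (G (b y)) • F x := by
    simpa using DFunLike.congr_fun (h (g.smulRight x)) y
  have haF (x : H) : a (F x) = f (G (b u)) • F x := by simpa [hf] using key f x u
  refine ⟨f (G (b u)), ContinuousLinearMap.ext fun x => by simpa using haF x,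
    ContinuousLinearMap.ext fun y => ?_⟩
  refine (SeparatingDual.eq_iff_forall_dual_eq (R := ℂ)).2 fun g => ?_
  have h1 := key g v y
  rw [haF, smul_smul] at h1
  simpa [mul_comm] using (smul_left_injective ℂ hv h1).symm

variable {A : Subalgebra ℂ (H →L[ℂ] H)}

theorem exists_smul_add_of_commute_corner {F G : A} (hF : F * F = F) (hG : G * G = G)
    (hF0 : F ≠ 0) (hG0 : G ≠ 0) (hA : ∀ z : H →L[ℂ] H, (F : H →L[ℂ] H) * z * G ∈ A) {c : A}
    (hcG : c * G = G * c) (hc : ∀ z, F * z = z → z * G = z → c * z = z * c) :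
    ∃ α : ℂ, c * (F + G) = α • (F + G) := by
  obtain ⟨α, h1, h2⟩ := exists_smul_of_intertwines (F := (F : H →L[ℂ] H)) (G := G) (a := c) (b := c)
    (by simpa using hF0) (by simpa using hG0) fun z => by
      have hF' : (F : H →L[ℂ] H) * F = F := congrArg Subtype.val hF
      have hG' : (G : H →L[ℂ] H) * G = G := congrArg Subtype.val hG
      refine congrArg Subtype.val (hc ⟨_, hA z⟩ (Subtype.ext ?_) (Subtype.ext ?_))
      · simp only [MulMemClass.coe_mul, ← mul_assoc, hF']
      · simp only [MulMemClass.coe_mul, mul_assoc, hG']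
  have h1' : c * F = α • F := Subtype.ext h1
  have h2' : G * c = α • G := Subtype.ext h2
  exact ⟨α, by rw [mul_add, hcG, h1', h2', smul_add]⟩

theorem isScalarCorner_add {F G : A} (hF : F * F = F) (hG : G * G = G)
    (hFG : F * G = 0) (hGF : G * F = 0) (hF0 : F ≠ 0) (hG0 : G ≠ 0)
    (hA : ∀ z : H →L[ℂ] H, (F : H →L[ℂ] H) * z * G ∈ A) : IsScalarCorner (F + G) := by
  intro c _ hc hr
  have hcF : c * F = F * c := hr F hF (by rw [add_mul, hF, hGF, add_zero])
    (by rw [mul_add, hF, hFG, add_zero])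
  have hcG : c * G = G * c := hr G hG (by rw [add_mul, hG, hFG, zero_add])
    (by rw [mul_add, hG, hGF, zero_add])
  obtain ⟨α, hα⟩ := exists_smul_add_of_commute_corner hF hG hF0 hG0 hA hcG fun z hFz hzG => by
    have hzF : z * F = 0 := by rw [← hzG, mul_assoc, hGF, mul_zero]
    have hGz : G * z = 0 := by rw [← hFz, ← mul_assoc, hGF, zero_mul]
    have hzz : z * z = 0 := by rw [← hFz, ← mul_assoc, mul_assoc F, hzF, mul_zero, zero_mul]
    have h := hr (F + z) (by rw [mul_add, add_mul, add_mul, hF, hzF, hFz, hzz]; simp)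
      (by rw [mul_add, add_mul, add_mul, hF, hGF, hFz, hGz]; simp)
      (by rw [mul_add, add_mul, add_mul, hF, hFG, hzF, hzG]; simp)
    rwa [mul_add, add_mul, hcF, add_right_inj] at h
  exact ⟨α, hc ▸ hα⟩

/-- Every nonzero idempotent operator dominates an idempotent of rank one. -/
theorem exists_rankOne_le {E : H →L[ℂ] H} (hE : E * E = E) (hE0 : E ≠ 0) :
    ∃ F : H →L[ℂ] H, F * F = F ∧ E * F = F ∧ F * E = F ∧ F ≠ 0 ∧
      ∀ z, ∃ α : ℂ, F * z * F = α • F := by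
  obtain ⟨u, hu⟩ : ∃ u, E u ≠ 0 := by
    by_contra! h; exact hE0 (ContinuousLinearMap.ext h)
  have hEE (x : H) : E (E x) = E x := DFunLike.congr_fun hE x
  obtain ⟨f, hf⟩ := SeparatingDual.exists_eq_one (R := ℂ) hu
  refine ⟨(f.comp E).smulRight (E u), ?_, ?_, ?_, ?_, fun z => ⟨f (E (z (E u))), ?_⟩⟩
  · ext x; simp [hEE, hf]
  · ext x; simp [hEE]
  · ext x; simp [hEE]
  · intro h
    have := DFunLike.congr_fun h u
    simp [hf, hu] at this
  · ext x; simp [smul_smul, mul_comm]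

theorem isScalarCorner_of_full {E : A} (hE : E * E = E)
    (hA : ∀ z : H →L[ℂ] H, (E : H →L[ℂ] H) * z * E ∈ A) : IsScalarCorner E := by
  by_cases hE0 : E = 0
  · intro c hc _ _
    exact ⟨0, by rw [← hc, hE0]; simp⟩
  have hE' : (E : H →L[ℂ] H) * E = E := congrArg Subtype.val hE
  obtain ⟨F, hF, hEF, hFE, hF0, hone⟩ := exists_rankOne_le hE' (by simpa using hE0)
  lift F to A using by rw [← hEF, ← hFE, ← mul_assoc]; exact hA F
  replace hF : F * F = F := Subtype.ext hF
  replace hF0 : F ≠ 0 := by simpa using hF0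
  have hEF₁ : E * F = F := Subtype.ext hEF
  have hFE₁ : F * E = F := Subtype.ext hFE
  by_cases hEF' : E - F = 0
  · intro c hc hc' _
    obtain ⟨α, hα⟩ := hone c
    obtain rfl := sub_eq_zero.1 hEF'
    exact ⟨α, by rw [← hc', ← hc]; exact Subtype.ext hα⟩
  · have h := isScalarCorner_add (F := F) (G := E - F) hF
      (by rw [mul_sub, sub_mul, sub_mul, hE, hF, hEF₁, hFE₁]; simp)
      (by rw [mul_sub, hF, hFE₁, sub_self]) (by rw [sub_mul, hF, hEF₁, sub_self]) hF0 hEF' fun z => by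
        have h := hA (F * z * (E - F))
        have : (E : H →L[ℂ] H) * (F * z * (E - F)) * E = F * z * (E - F) := by
          have h1 : ((E : H →L[ℂ] H) - F) * E = E - F := by rw [sub_mul, hE', hFE]
          rw [mul_assoc, mul_assoc _ _ (E : H →L[ℂ] H), h1, ← mul_assoc, ← mul_assoc, hEF]
        rwa [this] at h
    rwa [add_sub_cancel] at h

/-- A `k`-commuting map is proper as soon as the algebra contains complementary idempotents with
a full off-diagonal corner and scalar diagonal corners. -/
theorem kCommuting_proper_of_corner {k : ℕ} (hk : 2 ≤ k) {Θ : A →ₗ[ℂ] A}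
    (hΘ : ∀ T, iterComm k (Θ T) T = 0) {e : A} (he : e * e = e) (he0 : e ≠ 0) (he1 : 1 - e ≠ 0)
    (hA : ∀ z : H →L[ℂ] H, (e : H →L[ℂ] H) * z * (1 - e : A) ∈ A)
    (h₁ : IsScalarCorner e) (h₂ : IsScalarCorner (1 - e)) :
    ∃ l : ℂ, ∀ T, ∃ α : ℂ, Θ T - l • T = α • (1 : A) := by
  refine kCommuting_proper_of_idempotent hk hΘ he h₁ h₂ fun c hce hc => ?_
  obtain ⟨α, hα⟩ := exists_smul_add_of_commute_corner (F := e) (G := 1 - e) he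
    (by rw [mul_sub, sub_mul, sub_mul, he]; simp) he0 he1 hA
    (c := c) (by rw [mul_sub, sub_mul, hce, mul_one, one_mul])
    fun z hz hz' => hc z hz (by rw [← hz', mul_assoc, sub_mul, he]; simp)
  exact ⟨α, by simpa using hα⟩

end Operators

section Nest

variable {H : Type*} [NormedAddCommGroup H] [InnerProductSpace ℂ H] {𝒩 : Set (Submodule ℂ H)}

theorem starProjection_mem_nestAlg {N : Submodule ℂ H} [N.HasOrthogonalProjection]
    (hN : ∀ M ∈ 𝒩, M ≤ N ∨ N ≤ M) : N.starProjection ∈ nestAlg 𝒩 := by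
  intro M hM x hx
  rcases hN M hM with h | h
  · rwa [Submodule.starProjection_eq_self_iff.2 (h hx)]
  · exact h (N.starProjection_apply_mem x)

theorem starProjection_mul_of_le {M N : Submodule ℂ H} [M.HasOrthogonalProjection]
    [N.HasOrthogonalProjection] (h : M ≤ N) :
    N.starProjection * M.starProjection = M.starProjection ∧
      M.starProjection * N.starProjection = M.starProjection :=
  ⟨ContinuousLinearMap.ext fun x =>
    Submodule.starProjection_eq_self_iff.2 (h (M.starProjection_apply_mem x)),
    Submodule.starProjection_comp_starProjection_of_le h⟩

theorem starProjection_sub_ne_zero {M N : Submodule ℂ H} [M.HasOrthogonalProjection]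
    [N.HasOrthogonalProjection] (h : M < N) : N.starProjection - M.starProjection ≠ 0 := by
  obtain ⟨x, hxN, hxM⟩ := SetLike.exists_of_lt h
  intro h0
  have := DFunLike.congr_fun (sub_eq_zero.1 h0) x
  rw [Submodule.starProjection_eq_self_iff.2 hxN] at this
  exact hxM (this ▸ M.starProjection_apply_mem x)

theorem corner_mem_nestAlg {N₁ M₁ M₂ N₂ : Submodule ℂ H} [N₁.HasOrthogonalProjection]
    [M₁.HasOrthogonalProjection] [M₂.HasOrthogonalProjection] [N₂.HasOrthogonalProjection]
    (h₁ : N₁ ≤ M₁) (h₂ : M₂ ≤ N₂) (h : ∀ M ∈ 𝒩, M ≤ M₂ ∨ M₁ ≤ M) (z : H →L[ℂ] H) :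
    (M₁.starProjection - N₁.starProjection) * z * (N₂.starProjection - M₂.starProjection) ∈
      nestAlg 𝒩 := by
  intro M hM x hx
  rcases h M hM with h | h
  · have hx₁ := Submodule.starProjection_eq_self_iff.2 (h hx)
    have hx₂ := Submodule.starProjection_eq_self_iff.2 (h₂ (h hx))
    simp [hx₁, hx₂]
  · exact M.sub_mem (h (M₁.starProjection_apply_mem _)) (h (h₁ (N₁.starProjection_apply_mem _)))

theorem starProjection_sub_mul_self {M N : Submodule ℂ H} [M.HasOrthogonalProjection]
    [N.HasOrthogonalProjection] (h : M ≤ N) :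
    (N.starProjection - M.starProjection) * (N.starProjection - M.starProjection) =
      N.starProjection - M.starProjection := by
  rw [mul_sub, sub_mul, sub_mul, (starProjection_mul_of_le h).1, (starProjection_mul_of_le h).2,
    (starProjection_mul_of_le (le_refl N)).1, (starProjection_mul_of_le (le_refl M)).1]
  abel

theorem isScalarCorner_interval (hchain : ∀ N₁ ∈ 𝒩, ∀ N₂ ∈ 𝒩, N₁ ≤ N₂ ∨ N₂ ≤ N₁)
    (hproj : ∀ N ∈ 𝒩, N.HasOrthogonalProjection) {N₁ N₂ : Submodule ℂ H} (h₁ : N₁ ∈ 𝒩)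
    (h₂ : N₂ ∈ 𝒩) (hle : N₁ ≤ N₂) [N₁.HasOrthogonalProjection] [N₂.HasOrthogonalProjection]
    {E : nestAlg 𝒩} (hE : (E : H →L[ℂ] H) = N₂.starProjection - N₁.starProjection) :
    IsScalarCorner E := by
  by_cases hN : ∃ N ∈ 𝒩, N₁ < N ∧ N < N₂
  · obtain ⟨N, hN, hN₁, hN₂⟩ := hN
    have := hproj N hN
    have hmem {M : Submodule ℂ H} [M.HasOrthogonalProjection] (hM : M ∈ 𝒩) :
        M.starProjection ∈ nestAlg 𝒩 :=
      starProjection_mem_nestAlg fun M' hM' => hchain M' hM' M hM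
    obtain ⟨a₁, b₁⟩ := starProjection_mul_of_le hN₁.le
    obtain ⟨a₂, b₂⟩ := starProjection_mul_of_le hN₂.le
    obtain ⟨a₃, b₃⟩ := starProjection_mul_of_le hle
    have hNN := (starProjection_mul_of_le (le_refl N)).1
    let F : nestAlg 𝒩 := ⟨_, sub_mem (hmem hN) (hmem h₁)⟩
    let G : nestAlg 𝒩 := ⟨_, sub_mem (hmem h₂) (hmem hN)⟩
    have hEFG : E = F + G := Subtype.ext (by simp [hE, F, G])
    rw [hEFG]
    refine isScalarCorner_add (Subtype.ext (starProjection_sub_mul_self hN₁.le))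
      (Subtype.ext (starProjection_sub_mul_self hN₂.le))
      (Subtype.ext ?_) (Subtype.ext ?_)
      (fun h => starProjection_sub_ne_zero hN₁ (congrArg Subtype.val h))
      (fun h => starProjection_sub_ne_zero hN₂ (congrArg Subtype.val h))
      fun z => corner_mem_nestAlg hN₁.le hN₂.le (fun M hM => hchain M hM N hN) z
    · simp [F, G, mul_sub, sub_mul, b₁, b₂, b₃, hNN]
    · simp [F, G, mul_sub, sub_mul, a₁, a₂, a₃, hNN]
  · push Not at hN
    refine isScalarCorner_of_full (Subtype.ext ?_) fun z => ?_
    · simpa only [MulMemClass.coe_mul, hE] using starProjection_sub_mul_self hle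
    · rw [hE]
      refine corner_mem_nestAlg hle hle (fun M hM => ?_) z
      rcases hchain M hM N₁ h₁ with h | h
      · exact .inl h
      · rcases hchain M hM N₂ h₂ with h' | h'
        · by_cases hM₁ : N₁ = M
          · exact .inl hM₁.ge
          · exact .inr (not_lt_iff_le_imp_ge.1 (hN M hM (h.lt_of_ne hM₁)) h')
        · exact .inr h'

theorem kCommuting_nestAlg_exists_smul [CompleteSpace H]
    (hclosed : ∀ N ∈ 𝒩, IsClosed (N : Set H)) (hbot : ⊥ ∈ 𝒩) (htop : ⊤ ∈ 𝒩)
    (hchain : ∀ N₁ ∈ 𝒩, ∀ N₂ ∈ 𝒩, N₁ ≤ N₂ ∨ N₂ ≤ N₁) {k : ℕ} (hk : 2 ≤ k)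
    {Θ : nestAlg 𝒩 →ₗ[ℂ] nestAlg 𝒩} (hΘ : ∀ T, iterComm k (Θ T) T = 0) :
    ∃ l : ℂ, ∀ T, ∃ α : ℂ, Θ T - l • T = α • (1 : nestAlg 𝒩) := by
  have hproj (N) (hN : N ∈ 𝒩) : N.HasOrthogonalProjection := by
    have := (hclosed N hN).completeSpace_coe
    infer_instance
  by_cases hN : ∃ N ∈ 𝒩, N ≠ ⊥ ∧ N ≠ ⊤
  · obtain ⟨N, hN, hN0, hN1⟩ := hN
    have := hproj N hN
    let e : nestAlg 𝒩 :=
      ⟨N.starProjection, starProjection_mem_nestAlg fun M hM => hchain M hM N hN⟩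
    have he : (e : H →L[ℂ] H) = N.starProjection - (⊥ : Submodule ℂ H).starProjection := by
      simp [e]
    have he' : ((1 - e : nestAlg 𝒩) : H →L[ℂ] H) =
        (⊤ : Submodule ℂ H).starProjection - N.starProjection := by
      rw [Submodule.starProjection_top']
      rfl
    refine kCommuting_proper_of_corner hk hΘ (e := e)
      (Subtype.ext (starProjection_mul_of_le (le_refl N)).1) (fun h => ?_) (fun h => ?_)
      (fun z => ?_) (isScalarCorner_interval hchain hproj hbot hN bot_le he)
      (isScalarCorner_interval hchain hproj hN htop le_top he')
    · exact starProjection_sub_ne_zero (bot_lt_iff_ne_bot.2 hN0) (he ▸ congrArg Subtype.val h)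
    · exact starProjection_sub_ne_zero (lt_top_iff_ne_top.2 hN1) (he' ▸ congrArg Subtype.val h)
    · rw [he, he']
      exact corner_mem_nestAlg bot_le le_top (fun M hM => hchain M hM N hN) z
  · have hfull (z : H →L[ℂ] H) : z ∈ nestAlg 𝒩 := by
      intro M hM x hx
      by_cases hM0 : M = ⊥
      · subst hM0
        simp [(Submodule.mem_bot ℂ).1 hx]
      · have hM1 : M = ⊤ := by by_contra h; exact hN ⟨M, hM, hM0, h⟩
        simp [hM1]
    by_cases h10 : (1 : H →L[ℂ] H) = 0
    · have hz (z : nestAlg 𝒩) : z = 0 :=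
        Subtype.ext (by rw [← mul_one (z : H →L[ℂ] H), h10, mul_zero]; rfl)
      exact ⟨0, fun T => ⟨0, by rw [hz (Θ T - _), zero_smul]⟩⟩
    obtain ⟨F, hF, -, -, hF0, hone⟩ := exists_rankOne_le (one_mul (1 : H →L[ℂ] H)) h10
    by_cases h1F : 1 - F = 0
    · refine ⟨0, fun T => ?_⟩
      obtain ⟨α, hα⟩ := hone (Θ T)
      obtain rfl := sub_eq_zero.1 h1F
      exact ⟨α, Subtype.ext (by simpa using hα)⟩
    · have he : (⟨F, hfull F⟩ : nestAlg 𝒩) * ⟨F, hfull F⟩ = ⟨F, hfull F⟩ := Subtype.ext hF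
      refine kCommuting_proper_of_corner hk hΘ he
        (fun h => hF0 (congrArg Subtype.val h)) (fun h => h1F (congrArg Subtype.val h))
        (fun z => hfull _) (isScalarCorner_of_full he fun z => hfull _)
        (isScalarCorner_of_full ?_ fun z => hfull _)
      rw [mul_sub, sub_mul, sub_mul, he]
      simp

end Nest

/-- every k-commuting `ℂ`-linear map of a nest algebra `τ(𝒩)` on a complex
Hilbert space `H` is proper. A nest `𝒩` is a set of closed subspaces of `H` containing
`0` and `H`, totally ordered by inclusion, closed under intersections of subfamilies, and
closed under closed linear spans of unions of subfamilies. -/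
theorem kCommuting_nestAlgebra_proper
    {H : Type*} [NormedAddCommGroup H] [InnerProductSpace ℂ H] [CompleteSpace H]
    (𝒩 : Set (Submodule ℂ H))
    (hclosed : ∀ N ∈ 𝒩, IsClosed (N : Set H))
    (hbot : ⊥ ∈ 𝒩) (htop : ⊤ ∈ 𝒩)
    (hchain : ∀ N₁ ∈ 𝒩, ∀ N₂ ∈ 𝒩, N₁ ≤ N₂ ∨ N₂ ≤ N₁)
    (hinf : ∀ S ⊆ 𝒩, S.Nonempty → sInf S ∈ 𝒩)
    (hsup : ∀ S ⊆ 𝒩, S.Nonempty → (sSup S).topologicalClosure ∈ 𝒩)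
    (k : ℕ) (hk : 2 ≤ k)
    (Θ : nestAlg 𝒩 →ₗ[ℂ] nestAlg 𝒩)
    (hΘ : ∀ T : nestAlg 𝒩, iterComm k (Θ T) T = 0) :
    ∃ lam : nestAlg 𝒩, (∀ X, lam * X = X * lam) ∧
      ∃ ζ : nestAlg 𝒩 →ₗ[ℂ] nestAlg 𝒩,
        (∀ T X, ζ T * X = X * ζ T) ∧ ∀ T, Θ T = lam * T + ζ T := by
  obtain ⟨l, hl⟩ := kCommuting_nestAlg_exists_smul hclosed hbot htop hchain hk hΘ
  refine ⟨l • 1, fun X => by simp, Θ - l • LinearMap.id, fun T X => ?_, fun T => by simp⟩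
  obtain ⟨α, hα⟩ := hl T
  simp [hα]
end

section
/- Let n ≥ 2 and let d̄ = (d₁, …, d_m) be positive integers with d₁ + ⋯ + d_m = n. Then every ℂ-linear k-commuting map of the block upper triangular matrix algebra B_n^{d̄}(ℂ) is proper; likewise, every ℂ-linear k-commuting map of the block lower triangular matrix algebra B_n^{′d̄}(ℂ) is proper. -/
/-- The block upper triangular matrix algebra determined by a block function
`b : Fin n → Fin m` (the `(i, j)` entry vanishes whenever `b j < b i`),
as a subalgebra of `Mₙ(ℂ)`. -/
def blockUpperAlg (n m : ℕ) (b : Fin n → Fin m) :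
    Subalgebra ℂ (Matrix (Fin n) (Fin n) ℂ) where
  carrier := {X | X.BlockTriangular b}
  mul_mem' := fun {X Y} (hX : Matrix.BlockTriangular X b) (hY : Matrix.BlockTriangular Y b) =>
    Matrix.BlockTriangular.mul hX hY
  add_mem' := fun {X Y} (hX : Matrix.BlockTriangular X b) (hY : Matrix.BlockTriangular Y b) =>
    Matrix.BlockTriangular.add hX hY
  algebraMap_mem' := fun c => by
    show Matrix.BlockTriangular _ b
    rw [Matrix.algebraMap_eq_diagonal]
    exact Matrix.blockTriangular_diagonal _

/-- The block lower triangular matrix algebra determined by a block function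
`b : Fin n → Fin m` (the `(i, j)` entry vanishes whenever `b i < b j`),
as a subalgebra of `Mₙ(ℂ)`. -/
def blockLowerAlg (n m : ℕ) (b : Fin n → Fin m) :
    Subalgebra ℂ (Matrix (Fin n) (Fin n) ℂ) where
  carrier := {X | X.BlockTriangular (fun j => OrderDual.toDual (b j))}
  mul_mem' := fun {X Y} (hX : Matrix.BlockTriangular X fun j => OrderDual.toDual (b j))
      (hY : Matrix.BlockTriangular Y fun j => OrderDual.toDual (b j)) =>
    Matrix.BlockTriangular.mul hX hY
  add_mem' := fun {X Y} (hX : Matrix.BlockTriangular X fun j => OrderDual.toDual (b j))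
      (hY : Matrix.BlockTriangular Y fun j => OrderDual.toDual (b j)) =>
    Matrix.BlockTriangular.add hX hY
  algebraMap_mem' := fun c => by
    show Matrix.BlockTriangular _ fun j => OrderDual.toDual (b j)
    rw [Matrix.algebraMap_eq_diagonal]
    exact Matrix.blockTriangular_diagonal _

/-- `iterComm` commutes with ring homomorphisms. -/
theorem map_iterComm {R S : Type*} [Ring R] [Ring S] (f : R →+* S) (k : ℕ) (x y : R) :
    f (iterComm k x y) = iterComm k (f x) (f y) := by
  induction k with
  | zero => rfl
  | succ k ih => simp only [iterComm, map_sub, map_mul, ih]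

/-- If the kernels of `[·, y]²` and `[·, y]` agree, so do those of `[·, y]ᵏ⁺¹` and `[·, y]`. -/
theorem iterComm_one_eq_zero_of_iterComm_succ_eq_zero {R : Type*} [Ring R] {y : R}
    (hy : ∀ s : R, iterComm 2 s y = 0 → iterComm 1 s y = 0) (k : ℕ) {x : R}
    (h : iterComm (k + 1) x y = 0) : iterComm 1 x y = 0 := by
  induction k with
  | zero => exact h
  | succ k ih => exact ih (hy (iterComm k x y) h)

section Deformation

open Polynomial Matrix

variable {ι : Type*} [Fintype ι] [DecidableEq ι]

/-- A polynomial matrix whose constant term vanishes is divisible by the variable. -/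
theorem exists_eq_X_smul_of_constantCoeff_eq_zero {S : Matrix ι ι ℂ[X]}
    (h : (constantCoeff (R := ℂ)).mapMatrix S = 0) :
    ∃ T : Matrix ι ι ℂ[X], S = (X : ℂ[X]) • T := by
  have h' : ∀ i j, ∃ q, S i j = X * q := fun i j => X_dvd_iff.mpr (congrFun₂ h i j)
  choose T hT using h'
  exact ⟨Matrix.of T, by ext1 i j; simpa using hT i j⟩

/-- If the constant term of `Q` is diagonal with distinct entries, then `[S, Q]` is divisible by
all powers of the variable as soon as `[[S, Q], Q] = 0`. -/
theorem exists_iterComm_one_eq_X_pow_smul {d : ι → ℂ} (hd : Function.Injective d)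
    {Q : Matrix ι ι ℂ[X]} (hQ : (constantCoeff (R := ℂ)).mapMatrix Q = diagonal d) (N : ℕ) :
    ∀ S : Matrix ι ι ℂ[X], iterComm 2 S Q = 0 →
      ∃ T : Matrix ι ι ℂ[X], iterComm 1 S Q = (X ^ N : ℂ[X]) • T := by
  induction N with
  | zero => exact fun S _ => ⟨iterComm 1 S Q, by simp⟩
  | succ N ih =>
    intro S hS
    set S₀ := (constantCoeff (R := ℂ)).mapMatrix S with hS₀
    have h₀ : iterComm 2 S₀ (diagonal d) = 0 := by
      rw [hS₀, ← hQ, ← map_iterComm, hS, map_zero]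
    have hoff : ∀ i j, i ≠ j → S₀ i j = 0 := by
      intro i j hij
      have hz := congrFun₂ h₀ i j
      simp only [iterComm, Matrix.sub_apply, mul_diagonal, diagonal_mul, Matrix.zero_apply] at hz
      have hne : d j - d i ≠ 0 := sub_ne_zero.mpr fun e => hij (hd e).symm
      have : S₀ i j * (d j - d i) ^ 2 = 0 := by linear_combination hz
      exact (mul_eq_zero.mp this).resolve_right (pow_ne_zero 2 hne)
    let p : ℂ[X] := Lagrange.interpolate Finset.univ d (fun i => S₀ i i)
    let pQ : Matrix ι ι ℂ[X] := aeval Q p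
    have hpQ : (constantCoeff (R := ℂ)).mapMatrix pQ = S₀ := by
      have hev : ∀ M : Matrix ι ι ℂ[X],
          (constantCoeff (R := ℂ)).mapMatrix M = (aeval (0 : ℂ)).mapMatrix M := fun M => by
        ext1 i j
        simp [coeff_zero_eq_aeval_zero]
      have hdiagonal : aeval (diagonal d) p = diagonal fun i => p.eval (d i) := by
        rw [← diagonalAlgHom_apply ℂ d, aeval_algHom_apply, aeval_pi_apply]
        simp
      rw [hev, ← aeval_algHom_apply, ← hev, hQ, hdiagonal]
      ext i j
      rcases eq_or_ne i j with rfl | hij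
      · rw [diagonal_apply_eq]
        exact Lagrange.eval_interpolate_at_node _ hd.injOn (Finset.mem_univ i)
      · simp [hij, hoff i j hij]
    have hcomm : pQ * Q = Q * pQ := by
      simpa [pQ] using ((Commute.all p X).map (aeval Q)).eq
    obtain ⟨T, hT⟩ := exists_eq_X_smul_of_constantCoeff_eq_zero (S := S - pQ)
      (by rw [map_sub, hpQ, sub_self])
    have hS' : S = pQ + (X : ℂ[X]) • T := by rw [← hT]; abel
    have h1 : iterComm 1 S Q = (X : ℂ[X]) • iterComm 1 T Q := by
      simp only [iterComm, hS', add_mul, mul_add, hcomm, smul_mul_assoc, mul_smul_comm, smul_sub]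
      abel
    have h2 : (X : ℂ[X]) • iterComm 2 T Q = 0 := by
      rw [← hS]
      change _ = iterComm 1 S Q * Q - Q * iterComm 1 S Q
      rw [h1, smul_mul_assoc, mul_smul_comm, ← smul_sub]
      rfl
    obtain ⟨U, hU⟩ := ih T ((smul_eq_zero.mp h2).resolve_left X_ne_zero)
    exact ⟨U, by rw [h1, hU, smul_smul, pow_succ']⟩

/-- If the constant term of `Q` is diagonal with distinct entries, then `[·, Q]²` and `[·, Q]`
have the same kernel. -/
theorem iterComm_one_eq_zero_of_constantCoeff_eq_diagonal {d : ι → ℂ} (hd : Function.Injective d)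
    {Q : Matrix ι ι ℂ[X]} (hQ : (constantCoeff (R := ℂ)).mapMatrix Q = diagonal d)
    (S : Matrix ι ι ℂ[X]) (hS : iterComm 2 S Q = 0) : iterComm 1 S Q = 0 := by
  ext1 i j
  by_contra hne
  obtain ⟨T, hT⟩ :=
    exists_iterComm_one_eq_X_pow_smul hd hQ ((iterComm 1 S Q i j).natDegree + 1) S hS
  have hdvd : (X ^ ((iterComm 1 S Q i j).natDegree + 1) : ℂ[X]) ∣ iterComm 1 S Q i j :=
    ⟨T i j, by simpa using congrFun₂ hT i j⟩
  have := natDegree_le_of_dvd hdvd hne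
  rw [natDegree_X_pow] at this
  omega

/-- If the pencils `P₀ + t P₁` and `D + t Q₁` satisfy `[P₀ + t P₁, D + t Q₁]_{k+1} = 0` for all
`t`, where `D` is diagonal with distinct entries, then `P₁` and `Q₁` commute. -/
theorem commute_of_iterComm_pencil_eq_zero {d : ι → ℂ} (hd : Function.Injective d) (k : ℕ)
    {P₀ P₁ Q₁ : Matrix ι ι ℂ}
    (h : ∀ t : ℂ, iterComm (k + 1) (P₀ + t • P₁) (diagonal d + t • Q₁) = 0) :
    P₁ * Q₁ = Q₁ * P₁ := by
  let pencil (A B : Matrix ι ι ℂ) : Matrix ι ι ℂ[X] := A.map C + (X : ℂ[X]) • B.map C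
  have heval : ∀ (A B : Matrix ι ι ℂ) (t : ℂ),
      (evalRingHom t).mapMatrix (pencil A B) = A + t • B := by
    intro A B t
    ext1 i j
    simp [pencil]
    exact mul_comm _ _
  have hzero : iterComm (k + 1) (pencil P₀ P₁) (pencil (diagonal d) Q₁) = 0 := by
    ext1 i j
    refine Polynomial.funext fun t => ?_
    have ht := map_iterComm (evalRingHom t).mapMatrix (k + 1) (pencil P₀ P₁)
      (pencil (diagonal d) Q₁)
    rw [heval, heval, h t] at ht
    simpa using congrFun₂ ht i j
  have hconst : (constantCoeff (R := ℂ)).mapMatrix (pencil (diagonal d) Q₁) = diagonal d := by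
    ext1 i j
    rcases eq_or_ne i j with rfl | hij
    · simp [pencil]
    · simp [pencil, hij]
  have hone := iterComm_one_eq_zero_of_iterComm_succ_eq_zero
    (iterComm_one_eq_zero_of_constantCoeff_eq_diagonal hd hconst) k hzero
  have hquad : ∀ t : ℂ, (P₀ + t • P₁) * (diagonal d + t • Q₁)
      - (diagonal d + t • Q₁) * (P₀ + t • P₁) = 0 := by
    intro t
    have ht := map_iterComm (evalRingHom t).mapMatrix 1 (pencil P₀ P₁) (pencil (diagonal d) Q₁)
    rw [hone, map_zero, heval, heval] at ht
    exact ht.symm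
  have h0 := hquad 0
  have h1 := hquad 1
  have h2 := hquad (-1)
  simp only [zero_smul, add_zero, one_smul, neg_smul] at h0 h1 h2
  have hsum : (2 : ℂ) • (P₁ * Q₁ - Q₁ * P₁) = 0 := by
    have hexp : (2 : ℂ) • (P₁ * Q₁ - Q₁ * P₁)
        = ((P₀ + P₁) * (diagonal d + Q₁) - (diagonal d + Q₁) * (P₀ + P₁))
          + ((P₀ + -P₁) * (diagonal d + -Q₁) - (diagonal d + -Q₁) * (P₀ + -P₁))
          - 2 • (P₀ * diagonal d - diagonal d * P₀) := by
      rw [two_smul]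
      noncomm_ring
    rw [hexp, h0, h1, h2]
    simp
  exact sub_eq_zero.mp ((smul_eq_zero.mp hsum).resolve_left two_ne_zero)

end Deformation

/-- The matrix unit `(i, j)` is block triangular as soon as `b i ≤ b j`. -/
theorem Matrix.blockTriangular_single_one {ι α : Type*} [DecidableEq ι]
    [LinearOrder α] (b : ι → α) {i j : ι} (h : b i ≤ b j) :
    (Matrix.single i j (1 : ℂ)).BlockTriangular b := by
  intro r s hrs
  refine Matrix.single_apply_of_ne _ _ _ _ _ ?_
  rintro ⟨rfl, rfl⟩
  exact hrs.not_ge h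

section Commuting

open Matrix

variable {ι : Type*} [Fintype ι] [DecidableEq ι]

/-- On an algebra of matrices which contains the diagonal matrices and, for `i ≠ j`, one of the
matrix units `(i, j)` and `(j, i)`, every commuting linear map has the form
`X ↦ c X + (scalar matrix)`. -/
theorem exists_sub_smul_eq_scalar_of_commuting [Nontrivial ι]
    (A : Subalgebra ℂ (Matrix ι ι ℂ)) (hdiag : ∀ d : ι → ℂ, diagonal d ∈ A)
    (hsingle : ∀ i j, i ≠ j → single i j (1 : ℂ) ∈ A ∨ single j i (1 : ℂ) ∈ A)
    (Θ : A →ₗ[ℂ] A) {d : ι → ℂ} (hd : Function.Injective d)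
    (hΘ : ∀ X : A, (Θ X : Matrix ι ι ℂ) * X = X * Θ X) :
    ∃ c : ℂ, ∀ X : A, ∃ z : ℂ, (Θ X : Matrix ι ι ℂ) - c • (X : Matrix ι ι ℂ) = scalar ι z := by
  have hpol : ∀ X Y : A, (Θ X : Matrix ι ι ℂ) * Y - Y * Θ X + (Θ Y * X - X * Θ Y) = 0 := by
    intro X Y
    have h := hΘ (X + Y)
    simp only [map_add, Subalgebra.coe_add, add_mul, mul_add, hΘ X, hΘ Y] at h
    rw [← sub_eq_zero] at h
    rw [← h]
    abel
  let D : A := ⟨diagonal d, hdiag d⟩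
  let c (i j : ι) : ℂ := ((Θ D : Matrix ι ι ℂ) j j - (Θ D : Matrix ι ι ℂ) i i) / (d j - d i)
  have hne : ∀ {i j}, i ≠ j → d j - d i ≠ 0 := fun hij => sub_ne_zero.mpr fun e => hij (hd e).symm
  have hcsymm : ∀ i j, c i j = c j i := by
    intro i j
    simp only [c]
    rw [← neg_sub, ← neg_sub (d i), neg_div_neg_eq]
  have hΘD : ∀ i j, i ≠ j → (Θ D : Matrix ι ι ℂ) i j = 0 := by
    intro i j hij
    have h := congrFun₂ (hΘ D) i j
    simp only [D, mul_diagonal, diagonal_mul] at h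
    have : (Θ D : Matrix ι ι ℂ) i j * (d j - d i) = 0 := by linear_combination h
    exact (mul_eq_zero.mp this).resolve_right (hne hij)
  have hΘDdiag : (Θ D : Matrix ι ι ℂ) = diagonal fun i => (Θ D : Matrix ι ι ℂ) i i := by
    ext i j
    rcases eq_or_ne i j with rfl | hij
    · simp
    · rw [hΘD i j hij, diagonal_apply_ne _ hij]
  have hoff : ∀ (X : A) i j, i ≠ j →
      (Θ X : Matrix ι ι ℂ) i j = c i j * (X : Matrix ι ι ℂ) i j := by
    intro X i j hij
    have h := congrFun₂ (hpol X D) i j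
    rw [hΘDdiag] at h
    simp only [D, Matrix.add_apply, Matrix.sub_apply, mul_diagonal, diagonal_mul,
      Matrix.zero_apply] at h
    simp only [c]
    rw [div_mul_eq_mul_div, eq_div_iff (hne hij)]
    linear_combination h
  have hdg_of_mem : ∀ (X : A) i j, i ≠ j → single i j (1 : ℂ) ∈ A →
      (Θ X : Matrix ι ι ℂ) i i - (Θ X : Matrix ι ι ℂ) j j
        = c i j * ((X : Matrix ι ι ℂ) i i - (X : Matrix ι ι ℂ) j j) := by
    intro X i j hij hmem
    let E : A := ⟨single i j 1, hmem⟩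
    have hE : ∀ k l, k ≠ l → (Θ E : Matrix ι ι ℂ) k l = c i j * (single i j (1 : ℂ)) k l := by
      intro k l hkl
      rw [hoff E k l hkl]
      by_cases h : i = k ∧ j = l
      · obtain ⟨rfl, rfl⟩ := h
        rfl
      · simp [E, h]
    have hEE := congrFun₂ (hΘ E) i j
    simp [E] at hEE
    have hX := congrFun₂ (hpol X E) i j
    simp only [Matrix.add_apply, Matrix.sub_apply, Matrix.zero_apply] at hX
    have hΘE : (Θ E : Matrix ι ι ℂ) = c i j • single i j (1 : ℂ)
        + diagonal fun k => (Θ E : Matrix ι ι ℂ) k k := by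
      ext k l
      rcases eq_or_ne k l with rfl | hkl
      · have : ¬ (i = k ∧ j = k) := fun h => hij (h.1.trans h.2.symm)
        simp [this]
      · simp [-smul_single, hE k l hkl, hkl]
    rw [hΘE] at hX
    simp [E, add_mul, mul_add] at hX
    linear_combination hX - (X : Matrix ι ι ℂ) i j * hEE
  have hdg : ∀ (X : A) i j, i ≠ j →
      (Θ X : Matrix ι ι ℂ) i i - (Θ X : Matrix ι ι ℂ) j j
        = c i j * ((X : Matrix ι ι ℂ) i i - (X : Matrix ι ι ℂ) j j) := by
    intro X i j hij
    rcases hsingle i j hij with h | h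
    · exact hdg_of_mem X i j hij h
    · have := hdg_of_mem X j i hij.symm h
      rw [hcsymm i j]
      linear_combination -this
  have hcrow : ∀ i j l, i ≠ j → i ≠ l → c i j = c i l := by
    intro i j l hij hil
    rcases eq_or_ne j l with rfl | hjl
    · rfl
    let F : A := ⟨diagonal (Pi.single i 1), hdiag _⟩
    have h1 := hdg F i j hij
    have h2 := hdg F j l hjl
    have h3 := hdg F i l hil
    simp [F, hij.symm, hil.symm] at h1 h2 h3
    linear_combination h3 - h1 - h2
  obtain ⟨i₀, j₀, h₀⟩ := exists_pair_ne ι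
  have hc : ∀ i j, i ≠ j → c i j = c i₀ j₀ := by
    intro i j hij
    rcases eq_or_ne i i₀ with rfl | hi
    · exact hcrow _ _ _ hij h₀
    · rw [hcrow i j i₀ hij hi, hcsymm, hcrow i₀ i j₀ hi.symm h₀]
  refine ⟨c i₀ j₀, fun X => ⟨(Θ X : Matrix ι ι ℂ) i₀ i₀ - c i₀ j₀ * (X : Matrix ι ι ℂ) i₀ i₀, ?_⟩⟩
  ext i j
  rcases eq_or_ne i j with rfl | hij
  · rcases eq_or_ne i i₀ with rfl | hi
    · simp
    · have h := hdg X i i₀ hi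
      rw [hc i i₀ hi] at h
      simp
      linear_combination h
  · simp [hij, hoff X i j hij, hc i j hij]

/-- On an algebra of matrices which contains the diagonal matrices and, for `i ≠ j`, one of the
matrix units `(i, j)` and `(j, i)`, every `(k+1)`-commuting linear map is proper. -/
theorem proper_of_iterComm_eq_zero [Nontrivial ι]
    (A : Subalgebra ℂ (Matrix ι ι ℂ)) (hdiag : ∀ d : ι → ℂ, diagonal d ∈ A)
    (hsingle : ∀ i j, i ≠ j → single i j (1 : ℂ) ∈ A ∨ single j i (1 : ℂ) ∈ A)
    (k : ℕ) (Θ : A →ₗ[ℂ] A) (hΘ : ∀ X : A, iterComm (k + 1) (Θ X) X = 0) :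
    ∃ lam : A, (∀ X, lam * X = X * lam) ∧
      ∃ ζ : A →ₗ[ℂ] A, (∀ X Y, ζ X * Y = Y * ζ X) ∧ ∀ X, Θ X = lam * X + ζ X := by
  obtain ⟨d, hd⟩ : ∃ d : ι → ℂ, Function.Injective d :=
    ⟨fun i => ((Fintype.equivFin ι i : ℕ) : ℂ), fun i j h => by
      simpa [Fin.val_inj] using h⟩
  have hcomm : ∀ X : A, (Θ X : Matrix ι ι ℂ) * X = X * Θ X := by
    intro X
    refine commute_of_iterComm_pencil_eq_zero hd k
      (P₀ := Θ ⟨diagonal d, hdiag d⟩) fun t => ?_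
    have h := congrArg A.val (hΘ (⟨diagonal d, hdiag d⟩ + t • X))
    have hm := map_iterComm (A.val : A →+* Matrix ι ι ℂ) (k + 1)
      (Θ (⟨diagonal d, hdiag d⟩ + t • X)) (⟨diagonal d, hdiag d⟩ + t • X)
    simp only [RingHom.coe_coe] at hm
    rw [hm] at h
    simpa using h
  obtain ⟨c, hc⟩ := exists_sub_smul_eq_scalar_of_commuting A hdiag hsingle Θ hd hcomm
  refine ⟨algebraMap ℂ A c, fun X => Algebra.commutes c X, Θ - c • LinearMap.id, ?_, ?_⟩
  · intro X Y
    obtain ⟨z, hz⟩ := hc X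
    have : (Θ - c • LinearMap.id : A →ₗ[ℂ] A) X = algebraMap ℂ A z := Subtype.ext hz
    rw [this]
    exact Algebra.commutes z Y
  · intro X
    simp [Algebra.smul_def]

end Commuting

/-- let `n ≥ 2` and let `d̄ = (d₁, …, d_m)` be positive integers with
`d₁ + ⋯ + d_m = n`; partition `{1, …, n}` into consecutive blocks of sizes `d₁, …, d_m`,
encoded by the monotone block function `b : Fin n → Fin m` whose fibers have cardinalities
`dᵢ`. Then every `ℂ`-linear k-commuting map of the block upper triangular matrix algebra
`B_n^{d̄}(ℂ)` is proper, and likewise for the block lower triangular matrix algebra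
`B_n^{′d̄}(ℂ)`. -/
theorem kCommuting_blockTriangular_proper
    (n m : ℕ) (hn : 2 ≤ n) (d : Fin m → ℕ) (hd : ∀ i, 0 < d i)
    (hsum : ∑ i, d i = n)
    (b : Fin n → Fin m) (hmono : Monotone b)
    (hfiber : ∀ i : Fin m, (Finset.univ.filter fun j => b j = i).card = d i)
    (k : ℕ) (hk : 2 ≤ k) :
    (∀ Θ : blockUpperAlg n m b →ₗ[ℂ] blockUpperAlg n m b,
      (∀ X : blockUpperAlg n m b, iterComm k (Θ X) X = 0) →
      ∃ lam : blockUpperAlg n m b, (∀ X, lam * X = X * lam) ∧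
        ∃ ζ : blockUpperAlg n m b →ₗ[ℂ] blockUpperAlg n m b,
          (∀ X Y, ζ X * Y = Y * ζ X) ∧ ∀ X, Θ X = lam * X + ζ X) ∧
    (∀ Θ : blockLowerAlg n m b →ₗ[ℂ] blockLowerAlg n m b,
      (∀ X : blockLowerAlg n m b, iterComm k (Θ X) X = 0) →
      ∃ lam : blockLowerAlg n m b, (∀ X, lam * X = X * lam) ∧
        ∃ ζ : blockLowerAlg n m b →ₗ[ℂ] blockLowerAlg n m b,
          (∀ X Y, ζ X * Y = Y * ζ X) ∧ ∀ X, Θ X = lam * X + ζ X) := by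
  obtain ⟨k, rfl⟩ : ∃ l, k = l + 1 := ⟨k - 1, by omega⟩
  have : Nontrivial (Fin n) := Fin.nontrivial_iff_two_le.mpr hn
  refine ⟨fun Θ hΘ => proper_of_iterComm_eq_zero _ (fun _ => Matrix.blockTriangular_diagonal _)
      (fun i j _ => ?_) k Θ hΘ,
    fun Θ hΘ => proper_of_iterComm_eq_zero _ (fun _ => Matrix.blockTriangular_diagonal _)
      (fun i j _ => ?_) k Θ hΘ⟩
  · exact (le_total (b i) (b j)).imp (Matrix.blockTriangular_single_one b)
      (Matrix.blockTriangular_single_one b)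
  · exact (le_total (b j) (b i)).imp
      (fun h => Matrix.blockTriangular_single_one (fun j => OrderDual.toDual (b j)) h)
      (fun h => Matrix.blockTriangular_single_one (fun j => OrderDual.toDual (b j)) h)
end
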